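/- Let n ≥ 1 and let X, Y be consistent subsets of binom([n], 3) with X ⊊ Y. Then there exists I_0 ∈ Asc(X, Y) such that for every subset 𝓘 ⊆ Asc(X, Y) for which X ∪ cl(𝓘) is consistent, the set X ∪ cl(𝓘 ∪ {I_0}) is also consistent. -/

import Mathlib

open Finset

/-- `[n] = {1, …, n}`. -/
def box (n : ℕ) : Finset ℕ := Finset.Icc 1 n

/-- `binom([n], k)`, the set of `k`-element subsets of `[n]`. -/
def binom (n k : ℕ) : Finset (Finset ℕ) := Finset.powersetCard k (box n)

/-- `X ⊆ binom([n], d+1)` is closed if for every `(d-1)`-subset `I` of `[n]` and all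
`i < j < k` in `[n] ∖ I`, membership of `I∪{i,j}` and `I∪{j,k}` in `X` forces
`I∪{i,k} ∈ X`. -/
def IsClosedSet (n d : ℕ) (X : Finset (Finset ℕ)) : Prop :=
  ∀ I ∈ binom n (d - 1), ∀ i ∈ box n, ∀ j ∈ box n, ∀ k ∈ box n,
    i ∉ I → j ∉ I → k ∉ I → i < j → j < k →
      I ∪ {i, j} ∈ X → I ∪ {j, k} ∈ X → I ∪ {i, k} ∈ X

/-- `X` is a consistent subset of `binom([n], d+1)`:
both `X` and its complement in `binom([n], d+1)` are closed. -/
def Consistent (n d : ℕ) (X : Finset (Finset ℕ)) : Prop :=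
  X ⊆ binom n (d + 1) ∧ IsClosedSet n d X ∧ IsClosedSet n d (binom n (d + 1) \ X)

open Classical in
/-- The smallest closed subset of `binom([n], d+1)` containing `S`. -/
noncomputable def closureHB (n d : ℕ) (S : Finset (Finset ℕ)) : Finset (Finset ℕ) :=
  (binom n (d + 1)).filter fun I =>
    ∀ T ⊆ binom n (d + 1), S ⊆ T → IsClosedSet n d T → I ∈ T

open Classical in
/-- The ascent set `Asc(X, Y) = {I ∈ Y ∖ X : X ∪ {I} is consistent}`. -/
noncomputable def ascSet (n d : ℕ) (X Y : Finset (Finset ℕ)) : Finset (Finset ℕ) :=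
  (Y \ X).filter fun I => Consistent n d (X ∪ {I})

/-- The closedness condition for a ternary relation, read off packet by packet. -/
def PacketClosed (V : Finset ℕ) (R : ℕ → ℕ → ℕ → Prop) : Prop :=
  ∀ a ∈ V, ∀ b ∈ V, ∀ c ∈ V, ∀ d ∈ V, a < b → b < c → c < d →
    (R a b c → R a c d → R a b d) ∧ (R a b c → R b c d → R a b d) ∧
    (R a b c → R b c d → R a c d) ∧ (R a b d → R b c d → R a c d)

/-- A relation is packet consistent if it and its negation are packet closed. -/
def PacketConsistent (V : Finset ℕ) (R : ℕ → ℕ → ℕ → Prop) : Prop :=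
  PacketClosed V R ∧ PacketClosed V fun a b c => ¬ R a b c

/-- On pseudoline `q`, the crossing with `x` comes before the crossing with `y`. -/
def Bef (R : ℕ → ℕ → ℕ → Prop) (q x y : ℕ) : Prop :=
  (q < x ∧ x < y ∧ ¬ R q x y) ∨ (x < q ∧ q < y ∧ ¬ R x q y) ∨ (x < y ∧ y < q ∧ ¬ R x y q) ∨
  (q < y ∧ y < x ∧ R q y x) ∨ (y < q ∧ q < x ∧ R y q x) ∨ (y < x ∧ x < q ∧ R y x q)

/-- Pseudoline `l` passes below the crossing of `q` and `x`. -/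
def Bel (R : ℕ → ℕ → ℕ → Prop) (l q x : ℕ) : Prop :=
  (l < q ∧ Bef R q x l) ∨ (q < l ∧ Bef R q l x)

section Lines

variable {V : Finset ℕ} {R Y : ℕ → ℕ → ℕ → Prop} {q x y z l : ℕ}

theorem packet (hR : PacketConsistent V R) {a b c d : ℕ} (ha : a ∈ V) (hb : b ∈ V)
    (hc : c ∈ V) (hd : d ∈ V) (hab : a < b) (hbc : b < c) (hcd : c < d) :
    ((R a b c → R a c d → R a b d) ∧ (R a b c → R b c d → R a b d) ∧
      (R a b c → R b c d → R a c d) ∧ (R a b d → R b c d → R a c d)) ∧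
    ((¬ R a b c → ¬ R a c d → ¬ R a b d) ∧ (¬ R a b c → ¬ R b c d → ¬ R a b d) ∧
      (¬ R a b c → ¬ R b c d → ¬ R a c d) ∧ (¬ R a b d → ¬ R b c d → ¬ R a c d)) :=
  ⟨hR.1 a ha b hb c hc d hd hab hbc hcd, hR.2 a ha b hb c hc d hd hab hbc hcd⟩

theorem bef_bot (h : q < x) (h' : x < y) : Bef R q x y ↔ ¬ R q x y := by
  simp [Bef, h, h', h.not_gt, h'.not_gt, (h.trans h').not_gt]

theorem bef_bot' (h : q < x) (h' : x < y) : Bef R q y x ↔ R q x y := by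
  simp [Bef, h, h', h.not_gt, h'.not_gt, (h.trans h').not_gt]

theorem bef_mid (h : x < q) (h' : q < y) : Bef R q x y ↔ ¬ R x q y := by
  simp [Bef, h, h', h.not_gt, h'.not_gt, (h.trans h').not_gt]

theorem bef_mid' (h : x < q) (h' : q < y) : Bef R q y x ↔ R x q y := by
  simp [Bef, h, h', h.not_gt, h'.not_gt, (h.trans h').not_gt]

theorem bef_top (h : x < y) (h' : y < q) : Bef R q x y ↔ ¬ R x y q := by
  simp [Bef, h, h', h.not_gt, h'.not_gt, (h.trans h').not_gt]

theorem bef_top' (h : x < y) (h' : y < q) : Bef R q y x ↔ R x y q := by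
  simp [Bef, h, h', h.not_gt, h'.not_gt, (h.trans h').not_gt]

theorem bel_bot (h : l < x) (h' : x < y) : Bel R l x y ↔ R l x y := by
  simp [Bel, h, h.not_gt, bef_mid' h h']

theorem bel_mid (h : x < l) (h' : l < y) : Bel R l x y ↔ ¬ R x l y := by
  simp [Bel, h, h.not_gt, bef_bot h h']

theorem bel_top (h : x < y) (h' : y < l) : Bel R l x y ↔ R x y l := by
  simp [Bel, h.trans h', (h.trans h').not_gt, bef_bot' h h']

theorem Bef.ne (h : Bef R q x y) : q ≠ x ∧ q ≠ y ∧ x ≠ y := by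
  unfold Bef at h
  omega

theorem bef_or_iff (h1 : q ≠ x) (h2 : q ≠ y) (h : x < y) :
    Bef R q y x ↔ ¬ Bef R q x y := by
  rcases h1.lt_or_gt with g | g
  · simp [bef_bot g h, bef_bot' g h]
  · rcases h2.lt_or_gt with g' | g'
    · simp [bef_mid g g', bef_mid' g g']
    · simp [bef_top h g', bef_top' h g']

theorem bef_swap (h1 : q ≠ x) (h2 : q ≠ y) (h : x ≠ y) : Bef R q y x ↔ ¬ Bef R q x y := by
  rcases h.lt_or_gt with g | g
  · exact bef_or_iff h1 h2 g
  · rw [bef_or_iff h2 h1 g, not_not]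

theorem bef_asymm (h : Bef R q x y) : ¬ Bef R q y x := by
  obtain ⟨h1, h2, h3⟩ := h.ne
  simpa [bef_swap h1 h2 h3] using h

theorem bef_total (h1 : q ≠ x) (h2 : q ≠ y) (h : x ≠ y) : Bef R q x y ∨ Bef R q y x := by
  rw [bef_swap h1 h2 h]
  exact em _

theorem bel_symm (h : q ≠ x) (hlq : l ≠ q) (hlx : l ≠ x) : Bel R l q x ↔ Bel R l x q := by
  rcases h.lt_or_gt with g | g <;> rcases hlq.lt_or_gt with g' | g' <;>
    rcases hlx.lt_or_gt with g'' | g'' <;> first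
    | omega
    | simp [Bel, g', g'', g'.not_gt, g''.not_gt, bef_bot, bef_bot', bef_mid, bef_mid', bef_top,
        bef_top', g]

theorem not_cycle (hR : PacketConsistent V R) (hq : q ∈ V) (hx : x ∈ V)
    (hy : y ∈ V) (hz : z ∈ V) (hxy : x < y) (hyz : y < z) (h1 : q ≠ x) (h2 : q ≠ y)
    (h3 : q ≠ z) : (Bef R q x y → Bef R q y z → Bef R q x z) ∧
      (¬ Bef R q x y → ¬ Bef R q y z → ¬ Bef R q x z) := by
  have hxz := hxy.trans hyz
  rcases h1.lt_or_gt with g1 | g1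
  · have := packet hR hq hx hy hz g1 hxy hyz
    simp only [bef_bot g1 hxy, bef_bot g1 hxz, bef_bot (g1.trans hxy) hyz, not_not]
    exact ⟨this.2.1, this.1.1⟩
  rcases h2.lt_or_gt with g2 | g2
  · have := packet hR hx hq hy hz g1 g2 hyz
    simp only [bef_mid g1 g2, bef_mid g1 (g2.trans hyz), bef_bot g2 hyz, not_not]
    exact ⟨this.2.2.1, this.1.2.1⟩
  rcases h3.lt_or_gt with g3 | g3
  · have := packet hR hx hy hq hz hxy g2 g3
    simp only [bef_top hxy g2, bef_mid g1 g3, bef_mid g2 g3, not_not]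
    exact ⟨this.2.2.2.1, this.1.2.2.1⟩
  · have := packet hR hx hy hz hq hxy hyz g3
    simp only [bef_top hxy g2, bef_top hxz g3, bef_top hyz g3, not_not]
    exact ⟨this.2.2.2.2, this.1.2.2.2⟩

theorem bef_trans (hR : PacketConsistent V R) (hq : q ∈ V) (hx : x ∈ V)
    (hy : y ∈ V) (hz : z ∈ V) (h1 : Bef R q x y) (h2 : Bef R q y z) : Bef R q x z := by
  have hxz : x ≠ z := by
    rintro rfl
    exact bef_asymm h1 h2
  obtain ⟨a1, a2, a3⟩ := h1.ne
  obtain ⟨-, b2, b3⟩ := h2.ne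
  by_contra h
  have s1 := bef_swap (R := R) a1 a2 a3
  have s2 := bef_swap (R := R) a2 b2 b3
  have s3 := bef_swap (R := R) a1 b2 hxz
  rcases a3.lt_or_gt with g | g <;> rcases b3.lt_or_gt with g' | g' <;>
    rcases hxz.lt_or_gt with g'' | g''
  · exact h ((not_cycle hR hq hx hy hz g g' a1 a2 b2).1 h1 h2)
  · omega
  · have := not_cycle hR hq hx hz hy g'' g' a1 b2 a2
    tauto
  · have := not_cycle hR hq hz hx hy g'' g b2 a1 a2
    tauto
  · have := not_cycle hR hq hy hx hz g g'' a2 a1 b2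
    tauto
  · have := not_cycle hR hq hy hz hx g' g'' a2 b2 a1
    tauto
  · omega
  · have := not_cycle hR hq hz hy hx g' g b2 a2 a1
    tauto

/-- If two points of a line lie on the same side of `l`, so do all points between them. -/
theorem bel_between (hR : PacketConsistent V R) (hq : q ∈ V) (hx : x ∈ V)
    (hy : y ∈ V) (hz : z ∈ V) (hl : l ∈ V) (hlq : l ≠ q)
    (hxy : Bef R q x y) (hyz : Bef R q y z) (h : Bel R l q x ↔ Bel R l q z) :
    Bel R l q y ↔ Bel R l q x := by
  unfold Bel at *
  rcases hlq.lt_or_gt with g | g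
  · simp only [g, g.not_gt, true_and, false_and, or_false] at *
    exact ⟨bef_trans hR hq hx hy hl hxy, fun h' => bef_trans hR hq hy hz hl hyz (h.1 h')⟩
  · simp only [g, g.not_gt, true_and, false_and, false_or] at *
    exact ⟨fun h' => h.2 (bef_trans hR hq hl hy hz h' hyz),
      fun h' => bef_trans hR hq hl hx hy h' hxy⟩

theorem exists_last (hR : PacketConsistent V R) (hq : q ∈ V) {K : Finset ℕ} (hK : K.Nonempty)
    (hKV : ∀ k ∈ K, k ∈ V ∧ k ≠ q) : ∃ m ∈ K, ∀ k ∈ K, k ≠ m → Bef R q k m := by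
  induction hK using Finset.Nonempty.cons_induction with
  | singleton a => exact ⟨a, by simp⟩
  | cons a s ha hs ih =>
    obtain ⟨m, hm, h⟩ := ih fun k hk => hKV k (mem_cons_of_mem hk)
    have hma : m ≠ a := fun e => ha (e ▸ hm)
    have hmV := hKV m (mem_cons_of_mem hm)
    have haV := hKV a (mem_cons_self a s)
    rcases bef_total (R := R) hmV.2.symm haV.2.symm hma with g | g
    · refine ⟨a, mem_cons_self a s, fun k hk hka => ?_⟩
      rcases mem_cons.1 hk with rfl | hk
      · exact absurd rfl hka
      by_cases hkm : k = m
      · exact hkm ▸ g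
      · exact bef_trans hR hq (hKV k (mem_cons_of_mem hk)).1 hmV.1 haV.1 (h k hk hkm) g
    · refine ⟨m, mem_cons_of_mem hm, fun k hk hkm => ?_⟩
      rcases mem_cons.1 hk with rfl | hk
      · exact g
      · exact h k hk hkm

theorem exists_first (hR : PacketConsistent V R) (hq : q ∈ V) {K : Finset ℕ} (hK : K.Nonempty)
    (hKV : ∀ k ∈ K, k ∈ V ∧ k ≠ q) : ∃ m ∈ K, ∀ k ∈ K, k ≠ m → Bef R q m k := by
  induction hK using Finset.Nonempty.cons_induction with
  | singleton a => exact ⟨a, by simp⟩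
  | cons a s ha hs ih =>
    obtain ⟨m, hm, h⟩ := ih fun k hk => hKV k (mem_cons_of_mem hk)
    have hma : m ≠ a := fun e => ha (e ▸ hm)
    have hmV := hKV m (mem_cons_of_mem hm)
    have haV := hKV a (mem_cons_self a s)
    rcases bef_total (R := R) hmV.2.symm haV.2.symm hma with g | g
    · refine ⟨m, mem_cons_of_mem hm, fun k hk hkm => ?_⟩
      rcases mem_cons.1 hk with rfl | hk
      · exact g
      · exact h k hk hkm
    · refine ⟨a, mem_cons_self a s, fun k hk hka => ?_⟩
      rcases mem_cons.1 hk with rfl | hk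
      · exact absurd rfl hka
      by_cases hkm : k = m
      · exact hkm ▸ g
      · exact bef_trans hR hq haV.1 hmV.1 (hKV k (mem_cons_of_mem hk)).1 g (h k hk hkm)

end Lines

/-- Every line other than `a`, `b`, `c` passes on the same side of the crossings `ab`, `bc`. -/
def BaseFree (V : Finset ℕ) (R : ℕ → ℕ → ℕ → Prop) (a b c : ℕ) : Prop :=
  ∀ l ∈ V, l ≠ a → l ≠ b → l ≠ c → (Bel R l a b ↔ Bel R l b c)

/-- Every line other than `a`, `b`, `c` misses the triangle `abc`. -/
def Free (V : Finset ℕ) (R : ℕ → ℕ → ℕ → Prop) (a b c : ℕ) : Prop :=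
  ∀ l ∈ V, l ≠ a → l ≠ b → l ≠ c →
    (Bel R l a b ↔ Bel R l b c) ∧ (Bel R l a b ↔ Bel R l a c)

open Classical in
/-- The number of lines below the crossing `ab`, apart from `a`, `b`, `c`. -/
noncomputable def level (V : Finset ℕ) (R : ℕ → ℕ → ℕ → Prop) (a b c : ℕ) : ℕ :=
  #{l ∈ V | l ≠ a ∧ l ≠ b ∧ l ≠ c ∧ Bel R l a b}

section Triangles

variable {V : Finset ℕ} {R Y : ℕ → ℕ → ℕ → Prop} {a b c l p q r : ℕ}

theorem bel_of_bel_of_bel (hR : PacketConsistent V R) (ha : a ∈ V) (hb : b ∈ V) (hc : c ∈ V)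
    (hab : a < b) (hbc : b < c) (hn : ¬ R a b c) (hp : p ∈ V) (hpa : p ≠ a) (hpb : p ≠ b)
    (hpc : p ≠ c) (h1 : Bel R p a b) (h2 : Bel R p b c) : Bel R p a c := by
  have hac := hab.trans hbc
  rcases hpa.lt_or_gt with g1 | g1
  · rw [bel_bot g1 hab] at h1
    rw [bel_bot (g1.trans hab) hbc] at h2
    rw [bel_bot g1 hac]
    exact (packet hR hp ha hb hc g1 hab hbc).1.1 h1 h2
  rcases hpb.lt_or_gt with g2 | g2
  · rw [bel_mid g1 g2] at h1
    rw [bel_mid g1 (g2.trans hbc)]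
    exact (packet hR ha hp hb hc g1 g2 hbc).2.1 h1 hn
  rcases hpc.lt_or_gt with g3 | g3
  · rw [bel_top hab g2] at h1
    rw [bel_mid g1 g3]
    exact fun h => hn ((packet hR ha hb hp hc hab g2 g3).1.1 h1 h)
  · rw [bel_top hab g2] at h1
    rw [bel_top hbc g3] at h2
    rw [bel_top hac g3]
    exact (packet hR ha hb hc hp hab hbc g3).1.2.2.2 h1 h2

theorem gap_facts (hR : PacketConsistent V R) (hY : PacketConsistent V Y)
    (hRY : ∀ i j k, i < j → j < k → R i j k → Y i j k) (ha : a ∈ V) (hb : b ∈ V) (hc : c ∈ V)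
    (hab : a < b) (hbc : b < c) (hy : Y a b c) (hp : p ∈ V) (hpa : p ≠ a)
    (hpb : p ≠ b) (hpc : p ≠ c) (h1 : ¬ Bel R p a b) (h2 : ¬ Bel R p b c) (h3 : Bel R p a c) :
    a < p ∧ p < c ∧ ¬ R a p c ∧ Y a p c ∧ Bef R a b p ∧ Bef R c p b := by
  have hac := hab.trans hbc
  rcases hpa.lt_or_gt with g1 | g1
  · rw [bel_bot g1 hab] at h1
    rw [bel_bot (g1.trans hab) hbc] at h2
    rw [bel_bot g1 hac] at h3
    exact absurd h3 ((packet hR hp ha hb hc g1 hab hbc).2.1 h1 h2)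
  rcases hpb.lt_or_gt with g2 | g2
  · rw [bel_mid g1 g2, not_not] at h1
    rw [bel_bot g2 hbc] at h2
    rw [bel_mid g1 (g2.trans hbc)] at h3
    exact ⟨g1, g2.trans hbc, h3, (packet hY ha hp hb hc g1 g2 hbc).1.1 (hRY _ _ _ g1 g2 h1) hy,
      (bef_bot' g1 g2).2 h1, (bef_top g2 hbc).2 h2⟩
  rcases hpc.lt_or_gt with g3 | g3
  · rw [bel_top hab g2] at h1
    rw [bel_mid g2 g3, not_not] at h2
    rw [bel_mid g1 g3] at h3
    exact ⟨g1, g3, h3, (packet hY ha hb hp hc hab g2 g3).1.2.2.2 hy (hRY _ _ _ g2 g3 h2),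
      (bef_bot hab g2).2 h1, (bef_top' g2 g3).2 h2⟩
  · rw [bel_top hab g2] at h1
    rw [bel_top hbc g3] at h2
    rw [bel_top hac g3] at h3
    exact absurd h3 ((packet hR ha hb hc hp hab hbc g3).2.2.2.2 h1 h2)

/-- A segment of the upper hull, from `a` to `c`, of the lines in `K`. -/
structure Chord (R : ℕ → ℕ → ℕ → Prop) (K : Finset ℕ) (a c q r : ℕ) : Prop where
  left : q = a ∨ q ∈ K
  right : r = c ∨ r ∈ K
  lt : q < r
  ne : ¬ (q = a ∧ r = c)
  low_left : q ≠ a → ¬ R a q r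
  low_right : r ≠ c → ¬ R q r c
  above : ∀ l ∈ K, l ≠ q → l ≠ r → ¬ Bel R l q r

theorem Chord.bel_iff (hR : PacketConsistent V R) {K : Finset ℕ} (hKV : ∀ p ∈ K, p ∈ V)
    (ha : a ∈ V) (hc : c ∈ V)
    (hK : ∀ p ∈ K, a < p ∧ p < c ∧ (Bel R l a p ↔ Bel R l a c) ∧ (Bel R l p c ↔ Bel R l a c))
    (h : Chord R K a c q r) (hl : l ∈ V) (hlK : l ∉ K) (hla : l ≠ a) (hlc : l ≠ c) :
    Bel R l q r ↔ Bel R l a c := by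
  rcases h.left with rfl | hq
  · rcases h.right with rfl | hr
    · exact absurd ⟨rfl, rfl⟩ h.ne
    · exact (hK r hr).2.2.1
  · rcases h.right with rfl | hr
    · exact (hK q hq).2.2.2
    · obtain ⟨h1, h2, h3, h4⟩ := hK q hq
      obtain ⟨-, h6, -, -⟩ := hK r hr
      have hlq : l ≠ q := fun e => hlK (e ▸ hq)
      rw [bel_symm h1.ne hla hlq] at h3
      rw [bel_between hR (hKV q hq) ha (hKV r hr) hc hl hlq
        ((bef_mid h1 h.lt).2 (h.low_left h1.ne')) ((bef_bot h.lt h6).2 (h.low_right h6.ne))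
        (h3.trans h4.symm), h3]

theorem Chord.exists_triple (hR : PacketConsistent V R) (hY : PacketConsistent V Y)
    {K : Finset ℕ} (hKV : ∀ p ∈ K, p ∈ V ∧ a < p ∧ p < c) (ha : a ∈ V) (hc : c ∈ V)
    (hac : a < c) (h : Chord R K a c q r) (hqa : q ≠ a) (hYq : Y a q r) :
    ∃ p q r, Chord R K a c p q ∧ Chord R K a c q r ∧ q ∈ K ∧ Y p q r ∧ ¬ R p q r := by
  classical
  induction q using Nat.strong_induction_on generalizing r with
  | _ q ih =>
  have hq : q ∈ K := h.left.resolve_left hqa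
  obtain ⟨hqV, haq, hqc⟩ := hKV q hq
  have hrV : r ∈ V := by
    rcases h.right with rfl | hr
    exacts [hc, (hKV r hr).1]
  have hKa : ∀ k ∈ (insert a K).filter (fun x => x < q ∧ Bef R q x r), k ∈ V ∧ k ≠ q := by
    intro k hk
    obtain ⟨hk, hkq, -⟩ := mem_filter.1 hk
    rcases mem_insert.1 hk with rfl | hk
    exacts [⟨ha, hkq.ne⟩, ⟨(hKV k hk).1, hkq.ne⟩]
  have hmem : a ∈ (insert a K).filter (fun x => x < q ∧ Bef R q x r) :=
    mem_filter.2 ⟨mem_insert_self _ _, haq, (bef_mid haq h.lt).2 (h.low_left hqa)⟩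
  obtain ⟨p, hp, hlast⟩ := exists_last hR hqV ⟨a, hmem⟩ hKa
  obtain ⟨hpV, -⟩ := hKa p hp
  obtain ⟨hpK, hpq, hpr⟩ := mem_filter.1 hp
  have hpq' : Chord R K a c p q := by
    refine ⟨mem_insert.1 hpK, .inr hq, hpq, fun e => hqc.ne e.2, fun e => ?_, fun _ => ?_, ?_⟩
    · have hap := (hKV p ((mem_insert.1 hpK).resolve_left e)).2.1
      exact (bef_top hap hpq).1 (hlast a hmem e.symm)
    · rw [← bef_mid hpq hqc]
      rcases h.right with rfl | hr
      · exact hpr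
      · have hrc := (hKV r hr).2.2
        exact bef_trans hR hqV hpV hrV hc hpr ((bef_bot h.lt hrc).2 (h.low_right hrc.ne))
    · intro l hl hlp hlq hbel
      have hlV := (hKV l hl).1
      rw [bel_symm hpq.ne hlp hlq] at hbel
      rcases hbel with ⟨hlt, hbef⟩ | ⟨hlt, hbef⟩
      · have hlr : l ≠ r := (hlt.trans h.lt).ne
        rcases bef_total (R := R) hlq.symm h.lt.ne hlr with g | g
        · exact bef_asymm hbef
            (hlast l (mem_filter.2 ⟨mem_insert_of_mem hl, hlt, g⟩) hlp)
        · exact h.above l hl hlq hlr (.inl ⟨hlt, g⟩)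
      · have g := bef_trans hR hqV hlV hpV hrV hbef hpr
        exact h.above l hl hlq g.ne.2.2 (.inr ⟨hlt, g⟩)
  by_cases hL : p ≠ a ∧ Y a p q
  · exact ih p hpq hpq' hL.1 hL.2
  · refine ⟨p, q, r, hpq', h, hq, ?_, (bef_mid hpq h.lt).1 hpr⟩
    by_cases hpa : p = a
    · exact hpa ▸ hYq
    · have hap := (hKV p ((mem_insert.1 hpK).resolve_left hpa)).2.1
      by_contra hn
      exact (packet hY ha hpV hqV hrV hap hpq h.lt).2.2.2.1 (fun h' => hL ⟨hpa, h'⟩) hn hYq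

/-- A base free triple that is not free can be replaced by one of larger level. -/
theorem BaseFree.exists_level_lt (hR : PacketConsistent V R) (hY : PacketConsistent V Y)
    (hRY : ∀ i j k, i < j → j < k → R i j k → Y i j k) (ha : a ∈ V) (hb : b ∈ V) (hc : c ∈ V)
    (hab : a < b) (hbc : b < c) (hn : ¬ R a b c) (hy : Y a b c) (hB : BaseFree V R a b c)
    (hF : ¬ Free V R a b c) :
    ∃ p q r, p ∈ V ∧ q ∈ V ∧ r ∈ V ∧ p < q ∧ q < r ∧ Y p q r ∧ ¬ R p q r ∧
      BaseFree V R p q r ∧ level V R a b c < level V R p q r ∧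
      q ≠ a ∧ q ≠ b ∧ q ≠ c ∧ ¬ Bel R q a b := by
  classical
  have hac := hab.trans hbc
  set K := V.filter fun l => l ≠ a ∧ l ≠ b ∧ l ≠ c ∧ ¬ Bel R l a b ∧ Bel R l a c with hKdef
  have hbK : b ∉ K := by simp [hKdef]
  have hbb : Bel R b a c := (bel_mid hab hbc).2 hn
  have hout : ∀ l ∈ V, l ∉ K → l ≠ a → l ≠ b → l ≠ c →
      (Bel R l a b ↔ Bel R l a c) := by
    intro l hl hlK h1 h2 h3
    constructor
    · intro h
      exact bel_of_bel_of_bel hR ha hb hc hab hbc hn hl h1 h2 h3 h ((hB l hl h1 h2 h3).1 h)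
    · intro h
      by_contra h'
      exact hlK (mem_filter.2 ⟨hl, h1, h2, h3, h', h⟩)
  have hgap : ∀ p ∈ K, p ∈ V ∧ a < p ∧ p < c ∧ ¬ R a p c ∧ Y a p c ∧
      Bef R a b p ∧ Bef R c p b := by
    intro p hp
    obtain ⟨hpV, h1, h2, h3, h4, h5⟩ := mem_filter.1 hp
    exact ⟨hpV, gap_facts hR hY hRY ha hb hc hab hbc hy hpV h1 h2 h3 h4
      (mt (hB p hpV h1 h2 h3).2 h4) h5⟩
  have hKV : ∀ p ∈ K, p ∈ V ∧ a < p ∧ p < c := fun p hp =>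
    ⟨(hgap p hp).1, (hgap p hp).2.1, (hgap p hp).2.2.1⟩
  have hside : ∀ l ∈ V, l ∉ K → l ≠ a → l ≠ c → ∀ p ∈ K,
      a < p ∧ p < c ∧ (Bel R l a p ↔ Bel R l a c) ∧ (Bel R l p c ↔ Bel R l a c) := by
    intro l hl hlK hla hlc p hp
    obtain ⟨hpV, h1, h2, h3, h4, h5, h6⟩ := hgap p hp
    have hlp : l ≠ p := fun e => hlK (e ▸ hp)
    refine ⟨h1, h2, ?_⟩
    rw [bel_symm h2.ne hlp hlc]
    by_cases hlb : l = b
    · subst hlb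
      exact ⟨iff_of_true (.inr ⟨hab, h5⟩) hbb, iff_of_true (.inl ⟨hbc, h6⟩) hbb⟩
    · have o := hout l hl hlK hla hlb hlc
      have o' := hB l hl hla hlb hlc
      have s1 := bel_symm (R := R) hac.ne hla hlc
      have s2 := bel_symm (R := R) hbc.ne hlb hlc
      refine ⟨(bel_between hR ha hb hpV hc hl hla h5 ((bef_bot h1 h2).2 h3) o).trans o, ?_⟩
      exact (bel_between hR hc ha hpV hb hl hlc ((bef_top h1 h2).2 h3) h6
        (s1.symm.trans (o.symm.trans (o'.trans s2)))).trans s1.symm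
  have hKne : K.Nonempty := by
    by_contra hK
    rw [not_nonempty_iff_eq_empty] at hK
    exact hF fun l hl h1 h2 h3 =>
      ⟨hB l hl h1 h2 h3, hout l hl (by simp [hK]) h1 h2 h3⟩
  obtain ⟨m, hm, hlast⟩ := exists_last hR hc hKne fun k hk => ⟨(hKV k hk).1, (hKV k hk).2.2.ne⟩
  obtain ⟨hmV, h1, h2, h3, h4, -, -⟩ := hgap m hm
  have hch : Chord R K a c m c := by
    refine ⟨.inr hm, .inl rfl, h2, fun e => h1.ne' e.1, fun _ => h3, fun e => absurd rfl e, ?_⟩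
    intro l hl hlm hlc hbel
    rw [bel_symm h2.ne hlm hlc] at hbel
    rcases hbel with ⟨-, g⟩ | ⟨g, -⟩
    · exact bef_asymm g (hlast l hl hlm)
    · exact g.not_gt (hKV l hl).2.2
  obtain ⟨p, q, r, hpq, hqr, hq, hYt, hRt⟩ :=
    hch.exists_triple hR hY hKV ha hc hac h1.ne' h4
  obtain ⟨hqV, haq, hqc⟩ := hKV q hq
  obtain ⟨-, q1, q2, q3, q4, q5⟩ := mem_filter.1 hq
  have hp : p = a ∨ p ∈ K := hpq.left
  have hr : r = c ∨ r ∈ K := hqr.right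
  have hpV : p ∈ V := hp.elim (fun e => e ▸ ha) fun h => (hKV p h).1
  have hrV : r ∈ V := hr.elim (fun e => e ▸ hc) fun h => (hKV r h).1
  have hiff : ∀ {x y}, Chord R K a c x y → ∀ l ∈ V, l ∉ K → l ≠ a → l ≠ c →
      (Bel R l x y ↔ Bel R l a c) := fun h l hl hlK hla hlc =>
    h.bel_iff hR (fun p hp => (hKV p hp).1) ha hc (hside l hl hlK hla hlc) hl hlK hla hlc
  refine ⟨p, q, r, hpV, hqV, hrV, hpq.lt, hqr.lt, hYt, hRt, ?_, ?_, q1, q2, q3, q4⟩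
  · intro l hl hlp hlq hlr
    by_cases hlK : l ∈ K
    · exact iff_of_false (hpq.above l hlK hlp hlq) (hqr.above l hlK hlq hlr)
    by_cases hla : l = a
    · subst hla
      have hap : l < p := (hKV p (hp.resolve_left hlp.symm)).2.1
      rw [bel_bot hap hpq.lt, bel_bot haq hqr.lt]
      exact iff_of_false (hpq.low_left hlp.symm) (hqr.low_left haq.ne')
    by_cases hlc : l = c
    · subst hlc
      have hrc : r < l := (hKV r (hr.resolve_left hlr.symm)).2.2
      rw [bel_top hpq.lt hqc, bel_top hqr.lt hrc]
      exact iff_of_false (hpq.low_right hqc.ne) (hqr.low_right hrc.ne)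
    rw [hiff hpq l hl hlK hla hlc, hiff hqr l hl hlK hla hlc]
  · have hne : ∀ l, l ∉ K → l ≠ a → l ≠ c → l ≠ p ∧ l ≠ q ∧ l ≠ r := by
      refine fun l hlK hla hlc => ⟨?_, fun e => hlK (e ▸ hq), ?_⟩
      · rintro rfl
        exact hp.elim hla hlK
      · rintro rfl
        exact hr.elim hlc hlK
    refine card_lt_card ((ssubset_iff_of_subset fun l hl => ?_).2 ⟨b, ?_, by simp⟩)
    · simp only [mem_filter] at hl ⊢
      obtain ⟨hl, hla, hlb, hlc, hbel⟩ := hl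
      have hlK : l ∉ K := fun h => (mem_filter.1 h).2.2.2.2.1 hbel
      obtain ⟨n1, n2, n3⟩ := hne l hlK hla hlc
      exact ⟨hl, n1, n2, n3,
        (hiff hpq l hl hlK hla hlc).2 ((hout l hl hlK hla hlb hlc).1 hbel)⟩
    · obtain ⟨n1, n2, n3⟩ := hne b hbK hab.ne' hbc.ne
      exact mem_filter.2 ⟨hb, n1, n2, n3, (hiff hpq b hb hbK hab.ne' hbc.ne).2 hbb⟩

end Triangles

section Adjoin

variable {V C : Finset ℕ} {R Y : ℕ → ℕ → ℕ → Prop} {q x z l : ℕ}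

theorem bel_iff_of_not_between (hR : PacketConsistent V R) (hq : q ∈ V) (hx : x ∈ V)
    (hz : z ∈ V) (hl : l ∈ V) (hlq : l ≠ q) (hlx : l ≠ x) (hlz : l ≠ z)
    (hxz : Bef R q x z) (h : ¬ (Bef R q x l ∧ Bef R q l z)) : Bel R l q x ↔ Bel R l q z := by
  obtain ⟨h1, h2, h3⟩ := hxz.ne
  rw [not_and, ← bef_swap hlq.symm h2 hlz] at h
  unfold Bel
  rcases hlq.lt_or_gt with g | g
  · simp only [g, g.not_gt, true_and, false_and, or_false]
    exact ⟨h, bef_trans hR hq hx hz hl hxz⟩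
  · simp only [g, g.not_gt, true_and, false_and, false_or]
    refine ⟨fun h' => bef_trans hR hq hl hx hz h' hxz, fun h' => ?_⟩
    by_contra h''
    exact bef_asymm h' (h ((bef_swap hlq.symm h1 hlx).2 h''))

theorem exists_baseFree (hR : PacketConsistent V R) (hY : PacketConsistent V Y)
    (hRY : ∀ i j k, i < j → j < k → R i j k → Y i j k)
    (h : ∃ a ∈ V, ∃ b ∈ V, ∃ c ∈ V, a < b ∧ b < c ∧ Y a b c ∧ ¬ R a b c) :
    ∃ a ∈ V, ∃ b ∈ V, ∃ c ∈ V, a < b ∧ b < c ∧ Y a b c ∧ ¬ R a b c ∧ BaseFree V R a b c := by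
  classical
  obtain ⟨a₀, ha₀, b₀, hb₀, c₀, hc₀, h₀⟩ := h
  obtain ⟨c, hc, hcmin⟩ := exists_minimal (s := V.filter fun c => ∃ a ∈ V, ∃ b ∈ V,
    a < b ∧ b < c ∧ Y a b c ∧ ¬ R a b c) ⟨c₀, mem_filter.2 ⟨hc₀, a₀, ha₀, b₀, hb₀, h₀⟩⟩
  obtain ⟨hcV, a₁, ha₁, b₁, hb₁, hab₁, hbc₁, h₁⟩ := mem_filter.1 hc
  have hcm : ∀ x ∈ V, ∀ y ∈ V, ∀ z ∈ V, x < y → y < z → z < c → ¬ R x y z → ¬ Y x y z :=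
    fun x hx y hy z hz hxy hyz hzc hn hyy =>
      hzc.not_ge (hcmin (mem_filter.2 ⟨hz, x, hx, y, hy, hxy, hyz, hyy, hn⟩) hzc.le)
  obtain ⟨b, hb, hbmax⟩ := exists_maximal (s := V.filter fun b => b < c ∧ ∃ a ∈ V,
    a < b ∧ Y a b c ∧ ¬ R a b c) ⟨b₁, mem_filter.2 ⟨hb₁, hbc₁, a₁, ha₁, hab₁, h₁⟩⟩
  obtain ⟨hbV, hbc, a₂, ha₂, hab₂, h₂⟩ := mem_filter.1 hb
  have hbm : ∀ x ∈ V, ∀ y ∈ V, x < y → y < c → b < y → ¬ R x y c → ¬ Y x y c :=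
    fun x hx y hy hxy hyc hby hn hyy =>
      hby.not_ge (hbmax (mem_filter.2 ⟨hy, hyc, x, hx, hxy, hyy, hn⟩) hby.le)
  obtain ⟨a, ha, hlast⟩ := exists_last hR hbV (K := V.filter fun a => a < b ∧ Y a b c ∧
    ¬ R a b c) ⟨a₂, mem_filter.2 ⟨ha₂, hab₂, h₂⟩⟩ fun k hk =>
      ⟨(mem_filter.1 hk).1, (mem_filter.1 hk).2.1.ne⟩
  obtain ⟨haV, hab, hYabc, hnabc⟩ := mem_filter.1 ha
  have hleft : ∀ x ∈ V, x < c → Bef R b a x → Bef R b x c → False := by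
    intro x hx hxc h1 h2
    obtain ⟨-, hbx, hax⟩ := h1.ne
    rcases hbx.lt_or_gt with g | g
    · have n1 : ¬ Y a b x := hcm a haV b hbV x hx hab g hxc ((bef_mid hab g).1 h1)
      have n2 : ¬ Y b x c := hbm b hbV x hx g hxc g ((bef_bot g hxc).1 h2)
      exact (packet hY haV hbV hx hcV hab g hxc).2.2.1 n1 n2 hYabc
    · have n : ¬ Y x b c := fun hy => bef_asymm h1
        (hlast x (mem_filter.2 ⟨hx, g, hy, (bef_mid g hbc).1 h2⟩) hax.symm)
      rcases hax.lt_or_gt with g' | g'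
      · have n1 : ¬ Y a x b := hcm a haV x hx b hbV g' g hbc ((bef_top g' g).1 h1)
        exact (packet hY haV hx hbV hcV g' g hbc).2.2.2.1 n1 n hYabc
      · exact n ((packet hY hx haV hbV hcV g' hab hbc).1.2.2.1
          (hRY _ _ _ g' hab ((bef_top' g' hab).1 h1)) hYabc)
  have hcD : c ∈ V.filter fun x => c ≤ x ∧ Y a b x ∧ ¬ R a b x :=
    mem_filter.2 ⟨hcV, le_rfl, hYabc, hnabc⟩
  obtain ⟨d, hd, hfirst⟩ := exists_first hR hbV ⟨c, hcD⟩ fun k hk =>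
      ⟨(mem_filter.1 hk).1, (hbc.trans_le (mem_filter.1 hk).2.1).ne'⟩
  obtain ⟨hdV, hcd, hYabd, hnabd⟩ := mem_filter.1 hd
  have hbd := hbc.trans_le hcd
  refine ⟨a, haV, b, hbV, d, hdV, hab, hbd, hYabd, hnabd, fun l hl hla hlb hld => ?_⟩
  rw [bel_symm hab.ne hla hlb]
  refine bel_iff_of_not_between hR hbV haV hdV hl hlb hla hld ((bef_mid hab hbd).2 hnabd) ?_
  rintro ⟨h1, h2⟩
  have hlc : l ≠ c := by
    rintro rfl
    exact bef_asymm h2 (hfirst l hcD hld)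
  have h3 : Bef R b l c := by
    by_cases hdc : c = d
    · exact hdc ▸ h2
    · exact bef_trans hR hbV hl hdV hcV h2 (hfirst c hcD hdc)
  rcases hlc.lt_or_gt with g | g
  · exact hleft l hl g h1 h3
  · refine bef_asymm h2 (hfirst l (mem_filter.2 ⟨hl, g.le, ?_, (bef_mid hab (hbc.trans g)).1 h1⟩)
      hld)
    exact (packet hY haV hbV hcV hl hab hbc g).1.2.1 hYabc
      (hRY _ _ _ hbc g ((bef_bot' hbc g).1 h3))

/-- Adjoin to `R` all triples of elements of `C`. -/
def AdjoinTriples (R : ℕ → ℕ → ℕ → Prop) (C : Finset ℕ) (i j k : ℕ) : Prop :=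
  R i j k ∨ (i ∈ C ∧ j ∈ C ∧ k ∈ C)

theorem PacketConsistent.adjoinTriples (hR : PacketConsistent V R)
    (h : ∀ i ∈ C, ∀ j ∈ C, ∀ k ∈ C, i < j → j < k → ¬ R i j k → ∀ l ∈ V, l ∉ C →
      (Bel R l i j ↔ Bel R l j k) ∧ (Bel R l i j ↔ Bel R l i k)) :
    PacketConsistent V (AdjoinTriples R C) := by
  have key : ∀ a ∈ V, ∀ b ∈ V, ∀ c ∈ V, ∀ d ∈ V, a < b → b < c → c < d →
      let S := AdjoinTriples R C
      ((S a b c → S a c d → S a b d) ∧ (S a b c → S b c d → S a b d) ∧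
        (S a b c → S b c d → S a c d) ∧ (S a b d → S b c d → S a c d)) ∧
      ((¬ S a b c → ¬ S a c d → ¬ S a b d) ∧ (¬ S a b c → ¬ S b c d → ¬ S a b d) ∧
        (¬ S a b c → ¬ S b c d → ¬ S a c d) ∧ (¬ S a b d → ¬ S b c d → ¬ S a c d)) := by
    intro a ha b hb c hc d hd hab hbc hcd
    have hac := hab.trans hbc
    have hbd := hbc.trans hcd
    have hp := packet hR ha hb hc hd hab hbc hcd
    have h1 : a ∈ C → b ∈ C → c ∈ C → d ∉ C → ¬ R a b c →
        (R a b d ↔ R b c d) ∧ (R a b d ↔ R a c d) := by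
      intro m1 m2 m3 m4 n
      simpa only [bel_top hab hbd, bel_top hbc hcd, bel_top hac hcd] using
        h a m1 b m2 c m3 hab hbc n d hd m4
    have h2 : a ∈ C → b ∈ C → d ∈ C → c ∉ C → ¬ R a b d →
        (R a b c ↔ ¬ R b c d) ∧ (R a b c ↔ ¬ R a c d) := by
      intro m1 m2 m3 m4 n
      simpa only [bel_top hab hbc, bel_mid hbc hcd, bel_mid hac hcd] using
        h a m1 b m2 d m3 hab hbd n c hc m4
    have h3 : a ∈ C → c ∈ C → d ∈ C → b ∉ C → ¬ R a c d →
        (¬ R a b c ↔ R b c d) ∧ (¬ R a b c ↔ ¬ R a b d) := by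
      intro m1 m2 m3 m4 n
      simpa only [bel_mid hab hbc, bel_bot hbc hcd, bel_mid hab hbd] using
        h a m1 c m2 d m3 hac hcd n b hb m4
    have h4 : b ∈ C → c ∈ C → d ∈ C → a ∉ C → ¬ R b c d →
        (R a b c ↔ R a c d) ∧ (R a b c ↔ R a b d) := by
      intro m1 m2 m3 m4 n
      simpa only [bel_bot hab hbc, bel_bot hac hcd, bel_bot hab hbd] using
        h b m1 c m2 d m3 hbc hcd n a ha m4
    clear h hR
    simp only [AdjoinTriples]
    by_cases ma : a ∈ C <;> by_cases mb : b ∈ C <;> by_cases mc : c ∈ C <;>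
      by_cases md : d ∈ C <;>
      simp only [ma, mb, mc, md, true_and, and_true, and_false, or_true, or_false,
        not_true_eq_false, not_false_eq_true, forall_const, false_implies] at * <;>
      first
      | exact hp
      | grind
  exact ⟨fun a ha b hb c hc d hd h1 h2 h3 => (key a ha b hb c hc d hd h1 h2 h3).1,
    fun a ha b hb c hc d hd h1 h2 h3 => (key a ha b hb c hc d hd h1 h2 h3).2⟩

end Adjoin

open Classical in
/-- A set `C` of lines, all of whose triples can be adjoined to `R`, that no other line separates
and above at least `M` other lines. -/
structure Block (V : Finset ℕ) (R Y G : ℕ → ℕ → ℕ → Prop) (M : ℕ) (C : Finset ℕ) : Prop where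
  subset : C ⊆ V
  triple : ∀ i ∈ C, ∀ j ∈ C, ∀ k ∈ C, i < j → j < k → ¬ R i j k ∧ Y i j k ∧ G i j k
  side : ∀ l ∈ V, l ∉ C → ∀ i ∈ C, ∀ j ∈ C, ∀ i' ∈ C, ∀ j' ∈ C, i < j → i' < j' →
    (Bel R l i j ↔ Bel R l i' j')
  level : ∀ i ∈ C, ∀ j ∈ C, i < j → M ≤ #{l ∈ V | l ∉ C ∧ Bel R l i j}

section Block

variable {V C D : Finset ℕ} {R Y G : ℕ → ℕ → ℕ → Prop} {M : ℕ} {a x y z l : ℕ}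

theorem bel_adjoinTriples (h : l ∉ C ∨ x ∉ C ∨ y ∉ C) :
    Bel (AdjoinTriples R C) l x y ↔ Bel R l x y := by
  rcases h with h | h | h <;> simp [Bel, Bef, AdjoinTriples, h]

theorem Block.adjoinTriples (hR : PacketConsistent V R) (h : Block V R Y G M C) :
    PacketConsistent V (AdjoinTriples R C) :=
  hR.adjoinTriples fun i hi j hj k hk hij hjk _ l hl hlC =>
    ⟨h.side l hl hlC i hi j hj j hj k hk hij hjk,
      h.side l hl hlC i hi j hj i hi k hk hij (hij.trans hjk)⟩

theorem Block.mono (h : Block V R Y G M C) (hD : D ⊆ C)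
    (hDC : ∀ l ∈ C, l ∉ D → (∀ w ∈ D, l < w) ∨ ∀ w ∈ D, w < l) : Block V R Y G M D := by
  refine ⟨hD.trans h.subset, fun i hi j hj k hk => h.triple i (hD hi) j (hD hj) k (hD hk), ?_, ?_⟩
  · intro l hl hlD i hi j hj i' hi' j' hj' hij hij'
    by_cases hlC : l ∈ C
    · rcases hDC l hlC hlD with g | g
      · rw [bel_bot (g i hi) hij, bel_bot (g i' hi') hij']
        exact iff_of_false (h.triple l hlC i (hD hi) j (hD hj) (g i hi) hij).1
          (h.triple l hlC i' (hD hi') j' (hD hj') (g i' hi') hij').1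
      · rw [bel_top hij (g j hj), bel_top hij' (g j' hj')]
        exact iff_of_false (h.triple i (hD hi) j (hD hj) l hlC hij (g j hj)).1
          (h.triple i' (hD hi') j' (hD hj') l hlC hij' (g j' hj')).1
    · exact h.side l hl hlC i (hD hi) j (hD hj) i' (hD hi') j' (hD hj') hij hij'
  · intro i hi j hj hij
    refine (h.level i (hD hi) j (hD hj) hij).trans (card_le_card fun l hl => ?_)
    simp only [mem_filter] at hl ⊢
    exact ⟨hl.1, fun hlD => hl.2.1 (hD hlD), hl.2.2⟩

/-- A free triple of large level is a block. -/
theorem Block.of_free (hx : x ∈ V) (hy : y ∈ V) (hz : z ∈ V) (hxy : x < y) (hyz : y < z)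
    (h : ¬ R x y z ∧ Y x y z ∧ G x y z) (hF : Free V R x y z)
    (hM : M ≤ _root_.level V R x y z) : Block V R Y G M {x, y, z} := by
  classical
  have hside : ∀ l ∈ V, l ∉ ({x, y, z} : Finset ℕ) → ∀ i ∈ ({x, y, z} : Finset ℕ),
      ∀ j ∈ ({x, y, z} : Finset ℕ), i < j → (Bel R l i j ↔ Bel R l x y) := by
    intro l hl hlC i hi j hj hij
    simp only [mem_insert, mem_singleton, not_or] at hi hj hlC
    have := hF l hl hlC.1 hlC.2.1 hlC.2.2
    rcases hi with rfl | rfl | rfl <;> rcases hj with rfl | rfl | rfl <;> first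
      | omega
      | rfl
      | exact this.1.symm
      | exact this.2.symm
  refine ⟨?_, ?_, ?_, ?_⟩
  · simp [insert_subset_iff, hx, hy, hz]
  · intro i hi j hj k hk hij hjk
    simp only [mem_insert, mem_singleton] at hi hj hk
    obtain ⟨rfl, rfl, rfl⟩ : i = x ∧ j = y ∧ k = z := by omega
    exact h
  · intro l hl hlC i hi j hj i' hi' j' hj' hij hij'
    rw [hside l hl hlC i hi j hj hij, hside l hl hlC i' hi' j' hj' hij']
  · intro i hi j hj hij
    refine hM.trans (card_le_card fun l hl => ?_)
    obtain ⟨hl, h1, h2, h3, h4⟩ := mem_filter.1 hl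
    have hlC : l ∉ ({x, y, z} : Finset ℕ) := by simp [h1, h2, h3]
    exact mem_filter.2 ⟨hl, hlC, (hside l hl hlC i hi j hj hij).2 h4⟩

theorem Block.glue (hR : PacketConsistent V R) (hY : PacketConsistent V Y)
    (hG : PacketClosed V G) (hRY : ∀ i j k, i < j → j < k → R i j k → Y i j k)
    (hM : ∀ p ∈ V, ∀ q ∈ V, ∀ r ∈ V, p < q → q < r → Y p q r → ¬ R p q r →
      BaseFree V R p q r → _root_.level V R p q r ≤ M)
    (hx : x ∈ D) (hy : y ∈ D) (hxy : x < y) (ha : ∀ w ∈ D, a < w) (hz : ∀ w ∈ D, w < z)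
    (h₀ : Block V R Y G M (insert a D)) (h₁ : Block V R Y G M (insert z D)) :
    Block V R Y G M (insert a (insert z D)) := by
  classical
  obtain ⟨b, hb, hbmin⟩ := D.exists_minimal ⟨x, hx⟩
  replace hbmin : ∀ w ∈ D, w ≠ b → b < w := fun w hw hwb => by
    have := hbmin hw
    omega
  obtain ⟨c, hc, hbc⟩ : ∃ c ∈ D, b < c := by
    by_cases e : y = b
    · exact ⟨x, hx, hbmin x hx (by omega)⟩
    · exact ⟨y, hy, hbmin y hy e⟩
  have haV : a ∈ V := h₀.subset (mem_insert_self _ _)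
  have hzV : z ∈ V := h₁.subset (mem_insert_self _ _)
  have hDV : ∀ w ∈ D, w ∈ V := fun w hw => h₀.subset (mem_insert_of_mem hw)
  have hbV := hDV b hb
  have hab := ha b hb
  have hbz := hz b hb
  have haz := hab.trans hbz
  have hzC₀ : z ∉ insert a D := by
    rw [mem_insert, not_or]
    exact ⟨haz.ne', fun h => (hz z h).false⟩
  have a₀ : a ∈ insert a D := mem_insert_self _ _
  have z₁ : z ∈ insert z D := mem_insert_self _ _
  have d₀ : ∀ {w}, w ∈ D → w ∈ insert a D := mem_insert_of_mem
  have d₁ : ∀ {w}, w ∈ D → w ∈ insert z D := mem_insert_of_mem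
  have hmid : ∀ j ∈ D, ¬ R a j z ∧ Y a j z ∧ G a j z := by
    intro j hj
    obtain ⟨k, hk, hkj⟩ : ∃ k ∈ D, k ≠ j := by
      by_cases e : b = j
      · exact ⟨c, hc, e ▸ hbc.ne'⟩
      · exact ⟨b, hb, e⟩
    rcases hkj.lt_or_gt with g | g
    · obtain ⟨r1, y1, g1⟩ := h₀.triple a a₀ k (d₀ hk) j (d₀ hj) (ha k hk) g
      obtain ⟨r2, y2, g2⟩ := h₁.triple k (d₁ hk) j (d₁ hj) z z₁ g (hz j hj)
      have P := packet hR haV (hDV k hk) (hDV j hj) hzV (ha k hk) g (hz j hj)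
      have P' := packet hY haV (hDV k hk) (hDV j hj) hzV (ha k hk) g (hz j hj)
      have P'' := hG a haV k (hDV k hk) j (hDV j hj) z hzV (ha k hk) g (hz j hj)
      exact ⟨P.2.2.2.1 r1 r2, P'.1.2.2.1 y1 y2, P''.2.2.1 g1 g2⟩
    · obtain ⟨r1, y1, g1⟩ := h₀.triple a a₀ j (d₀ hj) k (d₀ hk) (ha j hj) g
      obtain ⟨r2, y2, g2⟩ := h₁.triple j (d₁ hj) k (d₁ hk) z z₁ g (hz k hk)
      have P := packet hR haV (hDV j hj) (hDV k hk) hzV (ha j hj) g (hz k hk)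
      have P' := packet hY haV (hDV j hj) (hDV k hk) hzV (ha j hj) g (hz k hk)
      have P'' := hG a haV j (hDV j hj) k (hDV k hk) z hzV (ha j hj) g (hz k hk)
      exact ⟨P.2.2.1 r1 r2, P'.1.2.1 y1 y2, P''.2.1 g1 g2⟩
  set Z := AdjoinTriples R (insert a D) with hZ
  have hZc : PacketConsistent V Z := h₀.adjoinTriples hR
  have hbl : ∀ l ∈ D, l ≠ b → Bel Z l a b := fun l hl hlb =>
    (bel_top hab (hbmin l hl hlb)).2 (.inr ⟨a₀, d₀ hb, d₀ hl⟩)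
  have hsub : ∀ l ∈ V, l ∉ insert a D → Bel R l a b →
      l ≠ a ∧ l ≠ b ∧ l ≠ z := by
    refine fun l _ hlC hbel => ⟨fun e => hlC (e ▸ a₀), fun e => hlC (e ▸ d₀ hb), ?_⟩
    rintro rfl
    exact (hmid b hb).1 ((bel_top hab hbz).1 hbel)
  obtain ⟨hRT, hYT, -⟩ := hmid b hb
  have hlev := h₀.level a a₀ b (d₀ hb) hab
  have hfree : Free V Z a b z := by
    by_contra hF
    have hB : BaseFree V Z a b z := by
      intro l hl hla hlb hlz
      by_cases hlD : l ∈ D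
      · refine iff_of_true (hbl l hlD hlb) ((bel_mid (hbmin l hlD hlb) (hz l hlD)).2 ?_)
        rintro (h | h)
        · exact (h₁.triple b (d₁ hb) l (d₁ hlD) z z₁ (hbmin l hlD hlb) (hz l hlD)).1 h
        · exact hzC₀ h.2.2
      · have hl₀ : l ∉ insert a D := by simp [hla, hlD]
        have hl₁ : l ∉ insert z D := by simp [hlz, hlD]
        rw [bel_adjoinTriples (.inl hl₀), bel_adjoinTriples (.inl hl₀),
          h₀.side l hl hl₀ a a₀ b (d₀ hb) b (d₀ hb) c (d₀ hc) hab hbc,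
          h₁.side l hl hl₁ b (d₁ hb) c (d₁ hc) b (d₁ hb) z z₁ hbc hbz]
    obtain ⟨p, q, r, hp, hq, hr, hpq, hqr, hYt, hZt, hBt, hlt, hqa, hqb, -, hqbel⟩ :=
      hB.exists_level_lt hZc hY (fun i j k hij hjk h => h.elim (hRY i j k hij hjk)
        fun h => (h₀.triple i h.1 j h.2.1 k h.2.2 hij hjk).2.1) haV hbV hzV hab hbz
        (fun h => h.elim hRT fun h => hzC₀ h.2.2) hYT hF
    have hq₀ : q ∉ insert a D := by
      rw [mem_insert, not_or]
      exact ⟨hqa, fun h => hqbel (hbl q h hqb)⟩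
    have e : ∀ l, Bel Z l p q ↔ Bel R l p q := fun l => bel_adjoinTriples (.inr (.inr hq₀))
    have e' : ∀ l, Bel Z l q r ↔ Bel R l q r := fun l => bel_adjoinTriples (.inr (.inl hq₀))
    have hle := hM p hp q hq r hr hpq hqr hYt (fun h => hZt (.inl h)) fun l hl h1 h2 h3 => by
      rw [← e, ← e', hBt l hl h1 h2 h3]
    have heq : _root_.level V Z p q r = _root_.level V R p q r := by
      simp only [_root_.level, e]
    refine (hlev.trans (card_le_card fun l hl => ?_)).not_gt ((heq ▸ hlt).trans_le hle)
    obtain ⟨hl, hl₀, hbel⟩ := mem_filter.1 hl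
    obtain ⟨n1, n2, n3⟩ := hsub l hl hl₀ hbel
    exact mem_filter.2 ⟨hl, n1, n2, n3, (bel_adjoinTriples (.inl hl₀)).2 hbel⟩
  have hC : ∀ w, w ∈ insert a (insert z D) ↔ w = a ∨ w = z ∨ w ∈ D := by simp
  have hout : ∀ l, l ∉ insert a (insert z D) → l ∉ insert a D ∧ l ∉ insert z D := by
    intro l hl
    simp only [mem_insert, not_or] at hl ⊢
    tauto
  have hside : ∀ l ∈ V, l ∉ insert a (insert z D) → ∀ i ∈ insert a (insert z D),
      ∀ j ∈ insert a (insert z D), i < j → (Bel R l i j ↔ Bel R l a b) := by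
    intro l hl hlC i hi j hj hij
    obtain ⟨hl₀, hl₁⟩ := hout l hlC
    rw [hC] at hi hj hlC
    rcases hi with rfl | rfl | hi
    · rcases hj with rfl | rfl | hj
      · exact absurd hij (lt_irrefl _)
      · have := (hfree l hl (by tauto) (fun e => hl₀ (e ▸ d₀ hb)) (by tauto)).2
        rw [bel_adjoinTriples (.inl hl₀), bel_adjoinTriples (.inl hl₀)] at this
        exact this.symm
      · exact h₀.side l hl hl₀ _ a₀ j (d₀ hj) _ a₀ b (d₀ hb) hij hab
    · rcases hj with rfl | rfl | hj
      · exact absurd hij haz.not_gt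
      · exact absurd hij (lt_irrefl _)
      · exact absurd hij (hz j hj).not_gt
    · rcases hj with rfl | rfl | hj
      · exact absurd hij (ha i hi).not_gt
      · rw [h₁.side l hl hl₁ i (d₁ hi) _ z₁ b (d₁ hb) c (d₁ hc) hij hbc]
        exact h₀.side l hl hl₀ b (d₀ hb) c (d₀ hc) a a₀ b (d₀ hb) hbc hab
      · exact h₀.side l hl hl₀ i (d₀ hi) j (d₀ hj) a a₀ b (d₀ hb) hij hab
  refine ⟨?_, ?_, ?_, ?_⟩
  · exact insert_subset haV h₁.subset
  · intro i hi j hj k hk hij hjk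
    rw [hC] at hi hj hk
    have ez : ∀ w, w = z ∨ w ∈ D → w ≤ z := fun w hw => hw.elim le_of_eq fun h => (hz w h).le
    have ea : ∀ w, w = a ∨ w = z ∨ w ∈ D → a ≤ w ∧ w ≤ z := by
      rintro w (rfl | rfl | h)
      exacts [⟨le_rfl, haz.le⟩, ⟨haz.le, le_rfl⟩, ⟨(ha w h).le, (hz w h).le⟩]
    have hjD : j ∈ D := by
      rcases hj with rfl | rfl | hj
      · exact absurd hij (ea i hi).1.not_gt
      · exact absurd hjk (ea k hk).2.not_gt
      · exact hj
    rcases hk with rfl | rfl | hk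
    · exact absurd (hij.trans hjk) (ea i hi).1.not_gt
    · rcases hi with rfl | rfl | hi
      · exact hmid j hjD
      · exact absurd hij (ea j hj).2.not_gt
      · exact h₁.triple i (d₁ hi) j (d₁ hjD) _ z₁ hij hjk
    · rcases hi with rfl | rfl | hi
      · exact h₀.triple _ a₀ j (d₀ hjD) k (d₀ hk) hij hjk
      · exact absurd hij (ea j hj).2.not_gt
      · exact h₀.triple i (d₀ hi) j (d₀ hjD) k (d₀ hk) hij hjk
  · intro l hl hlC i hi j hj i' hi' j' hj' hij hij'
    rw [hside l hl hlC i hi j hj hij, hside l hl hlC i' hi' j' hj' hij']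
  · intro i hi j hj hij
    refine hlev.trans (card_le_card fun l hl => ?_)
    obtain ⟨hl, hl₀, hbel⟩ := mem_filter.1 hl
    have hlC : l ∉ insert a (insert z D) := by
      rw [hC]
      rintro (rfl | rfl | h)
      exacts [hl₀ a₀, (hsub l hl hl₀ hbel).2.2 rfl, hl₀ (d₀ h)]
    exact mem_filter.2 ⟨hl, hlC, (hside l hl hlC i hi j hj hij).2 hbel⟩

/-- A block can be extended upwards along a free triple through its last two elements. -/
theorem Block.insert_right (hR : PacketConsistent V R) (hY : PacketConsistent V Y)
    (hG : PacketClosed V G) (hRY : ∀ i j k, i < j → j < k → R i j k → Y i j k)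
    (hM : ∀ p ∈ V, ∀ q ∈ V, ∀ r ∈ V, p < q → q < r → Y p q r → ¬ R p q r →
      BaseFree V R p q r → _root_.level V R p q r ≤ M)
    (h : Block V R Y G M C) (hx : x ∈ C) (hy : y ∈ C) (hxy : x < y)
    (hlast : ∀ w ∈ C, w ≤ x ∨ w = y) (hz : z ∈ V) (hyz : y < z)
    (ht : ¬ R x y z ∧ Y x y z ∧ G x y z) (hF : Free V R x y z) :
    Block V R Y G M (insert z C) := by
  classical
  have hCz : ∀ w ∈ C, w < z := fun w hw => by
    rcases hlast w hw with g | g <;> omega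
  suffices H : ∀ d, Block V R Y G M (insert z (C.filter fun w => x ≤ w + d)) by
    simpa [filter_true_of_mem fun w (_ : w ∈ C) => Nat.le_add_left x w] using H x
  intro d
  induction d with
  | zero =>
    have hxyz : insert z (C.filter fun w => x ≤ w + 0) = {x, y, z} := by
      ext w
      simp only [mem_insert, mem_filter, mem_singleton, add_zero]
      constructor
      · rintro (rfl | ⟨hw, h'⟩)
        · simp
        · rcases hlast w hw with g | g <;> omega
      · rintro (rfl | rfl | rfl)
        exacts [.inr ⟨hx, le_rfl⟩, .inr ⟨hy, hxy.le⟩, .inl rfl]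
    rw [hxyz]
    refine Block.of_free (h.subset hx) (h.subset hy) hz hxy hyz ht hF
      ((h.level x hx y hy hxy).trans (card_le_card fun l hl => ?_))
    obtain ⟨hl, hlC, hbel⟩ := mem_filter.1 hl
    refine mem_filter.2 ⟨hl, fun e => hlC (e ▸ hx), fun e => hlC (e ▸ hy), ?_, hbel⟩
    rintro rfl
    exact ht.1 ((bel_top hxy hyz).1 hbel)
  | succ d ih =>
    by_cases hk : ∃ k ∈ C, k + (d + 1) = x
    · obtain ⟨k, hkC, hkd⟩ := hk
      have e : C.filter (fun w => x ≤ w + (d + 1)) =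
          insert k (C.filter fun w => x ≤ w + d) := by
        ext w
        simp only [mem_insert, mem_filter]
        constructor
        · rintro ⟨hw, h'⟩
          by_cases e : w = k
          exacts [.inl e, .inr ⟨hw, by omega⟩]
        · rintro (rfl | ⟨hw, h'⟩)
          exacts [⟨hkC, by omega⟩, ⟨hw, by omega⟩]
      rw [e, insert_comm]
      refine Block.glue hR hY hG hRY hM (mem_filter.2 ⟨hx, by omega⟩)
        (mem_filter.2 ⟨hy, by omega⟩) hxy (fun w hw => ?_) (fun w hw => ?_) ?_ ih
      · have := (mem_filter.1 hw).2
        omega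
      · exact hCz w (mem_filter.1 hw).1
      · rw [← e]
        refine h.mono (filter_subset _ _) fun l hl hl' => .inl fun w hw => ?_
        have := (mem_filter.1 hw).2
        have : ¬ x ≤ l + (d + 1) := fun g => hl' (mem_filter.2 ⟨hl, g⟩)
        omega
    · have e : C.filter (fun w => x ≤ w + (d + 1)) = C.filter fun w => x ≤ w + d := by
        refine filter_congr fun w hw => ?_
        have : w + (d + 1) ≠ x := fun g => hk ⟨w, hw, g⟩
        omega
      rwa [e]

/-- A block can be extended downwards along a free triple through its first two elements. -/
theorem Block.insert_left (hR : PacketConsistent V R) (hY : PacketConsistent V Y)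
    (hG : PacketClosed V G) (hRY : ∀ i j k, i < j → j < k → R i j k → Y i j k)
    (hM : ∀ p ∈ V, ∀ q ∈ V, ∀ r ∈ V, p < q → q < r → Y p q r → ¬ R p q r →
      BaseFree V R p q r → _root_.level V R p q r ≤ M)
    (h : Block V R Y G M C) (hx : x ∈ C) (hy : y ∈ C) (hxy : x < y)
    (hfirst : ∀ w ∈ C, w = x ∨ y ≤ w) (hz : z ∈ V) (hzx : z < x)
    (ht : ¬ R z x y ∧ Y z x y ∧ G z x y) (hF : Free V R z x y) :
    Block V R Y G M (insert z C) := by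
  classical
  have hCz : ∀ w ∈ C, z < w := fun w hw => by
    rcases hfirst w hw with g | g <;> omega
  suffices H : ∀ d, Block V R Y G M (insert z (C.filter fun w => w ≤ y + d)) by
    have h' := H (C.sup id)
    rwa [filter_true_of_mem fun w hw =>
      show w ≤ _ from (Finset.le_sup (f := id) hw).trans (Nat.le_add_left _ y)] at h'
  intro d
  induction d with
  | zero =>
    have hxyz : insert z (C.filter fun w => w ≤ y + 0) = {z, x, y} := by
      ext w
      simp only [mem_insert, mem_filter, mem_singleton, add_zero]
      constructor
      · rintro (rfl | ⟨hw, h'⟩)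
        · simp
        · rcases hfirst w hw with g | g <;> omega
      · rintro (rfl | rfl | rfl)
        exacts [.inl rfl, .inr ⟨hx, hxy.le⟩, .inr ⟨hy, le_rfl⟩]
    rw [hxyz]
    refine Block.of_free hz (h.subset hx) (h.subset hy) hzx hxy ht hF
      ((h.level x hx y hy hxy).trans (card_le_card fun l hl => ?_))
    obtain ⟨hl, hlC, hbel⟩ := mem_filter.1 hl
    have hlx : l ≠ x := fun e => hlC (e ▸ hx)
    have hly : l ≠ y := fun e => hlC (e ▸ hy)
    have hlz : l ≠ z := by
      rintro rfl
      exact ht.1 ((bel_bot hzx hxy).1 hbel)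
    exact mem_filter.2 ⟨hl, hlz, hlx, hly, (hF l hl hlz hlx hly).1.2 hbel⟩
  | succ d ih =>
    by_cases hk : ∃ k ∈ C, k = y + (d + 1)
    · obtain ⟨k, hkC, hkd⟩ := hk
      have e : C.filter (fun w => w ≤ y + (d + 1)) =
          insert k (C.filter fun w => w ≤ y + d) := by
        ext w
        simp only [mem_insert, mem_filter]
        constructor
        · rintro ⟨hw, h'⟩
          by_cases e : w = k
          exacts [.inl e, .inr ⟨hw, by omega⟩]
        · rintro (rfl | ⟨hw, h'⟩)
          exacts [⟨hkC, by omega⟩, ⟨hw, by omega⟩]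
      rw [e]
      refine Block.glue hR hY hG hRY hM (mem_filter.2 ⟨hx, by omega⟩)
        (mem_filter.2 ⟨hy, by omega⟩) hxy (fun w hw => ?_) (fun w hw => ?_) ih ?_
      · exact hCz w (mem_filter.1 hw).1
      · have := (mem_filter.1 hw).2
        omega
      · rw [← e]
        refine h.mono (filter_subset _ _) fun l hl hl' => .inr fun w hw => ?_
        have := (mem_filter.1 hw).2
        have : ¬ l ≤ y + (d + 1) := fun g => hl' (mem_filter.2 ⟨hl, g⟩)
        omega
    · have e : C.filter (fun w => w ≤ y + (d + 1)) = C.filter fun w => w ≤ y + d := by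
        refine filter_congr fun w hw => ?_
        have : w ≠ y + (d + 1) := fun g => hk ⟨w, hw, g⟩
        omega
      rwa [e]

end Block

/-- Lines outside the range of `x`, `y`, `z` do not separate the triple. -/
def OuterFree (V : Finset ℕ) (R : ℕ → ℕ → ℕ → Prop) (x y z : ℕ) : Prop :=
  ¬ R x y z ∧ (∀ w ∈ V, w < x → (R w x y ↔ R w x z) ∧ (R w x y ↔ R w y z)) ∧
    ∀ w ∈ V, z < w → (R x y w ↔ R x z w) ∧ (R x y w ↔ R y z w)

section MaximalBlock

variable {V C : Finset ℕ} {R Y G E : ℕ → ℕ → ℕ → Prop} {M : ℕ} {x y z : ℕ}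

theorem Free.outerFree (hF : Free V R x y z) (hxy : x < y) (hyz : y < z) (hn : ¬ R x y z) :
    OuterFree V R x y z := by
  have hxz := hxy.trans hyz
  refine ⟨hn, fun w hw hwx => ?_, fun w hw hzw => ?_⟩
  · have := hF w hw hwx.ne (hwx.trans hxy).ne (hwx.trans hxz).ne
    rw [bel_bot hwx hxy, bel_bot (hwx.trans hxy) hyz, bel_bot hwx hxz] at this
    exact this.symm
  · have := hF w hw (hxz.trans hzw).ne' (hyz.trans hzw).ne' hzw.ne'
    rw [bel_top hxy (hyz.trans hzw), bel_top hyz hzw, bel_top hxz hzw] at this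
    exact this.symm

theorem packetClosed_outerFree (hR : PacketConsistent V R) :
    PacketClosed V (OuterFree V R) := by
  intro a ha b hb c hc d hd hab hbc hcd
  have hp := (packet hR ha hb hc hd hab hbc hcd).2
  have hlow : ∀ w ∈ V, w < a → _ := fun w hw hwa =>
    And.intro (packet hR hw ha hb hd hwa hab (hbc.trans hcd))
      (And.intro (packet hR hw ha hc hd hwa (hab.trans hbc) hcd)
      (packet hR hw hb hc hd (hwa.trans hab) hbc hcd))
  have hlow' : ∀ w ∈ V, w < a → _ := fun w hw hwa =>
    packet hR hw ha hb hc hwa hab hbc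
  have hup : ∀ w ∈ V, d < w → _ := fun w hw hdw =>
    And.intro (packet hR ha hb hd hw hab (hbc.trans hcd) hdw)
      (And.intro (packet hR ha hc hd hw (hab.trans hbc) hcd hdw)
      (packet hR hb hc hd hw hbc hcd hdw))
  have hup' : ∀ w ∈ V, d < w → _ := fun w hw hdw =>
    packet hR ha hb hc hw hab hbc (hcd.trans hdw)
  refine ⟨?_, ?_, ?_, ?_⟩
  all_goals
    rintro ⟨n1, l1, u1⟩ ⟨n2, l2, u2⟩
    refine ⟨by tauto, fun w hw hwa => ?_, fun w hw hdw => ?_⟩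
    · have q1 := l1 w hw (by omega)
      have q2 := l2 w hw (by omega)
      have q3 := hlow w hw (by omega)
      have q4 := hlow' w hw (by omega)
      clear hlow hlow' hup hup' l1 l2 u1 u2 hR
      grind
    · have q1 := u1 w hw (by omega)
      have q2 := u2 w hw (by omega)
      have q3 := hup w hw (by omega)
      have q4 := hup' w hw (by omega)
      clear hlow hlow' hup hup' l1 l2 u1 u2 hR
      grind

theorem Block.eq_or_le_of_free (h : Block V R Y G M C) (hx : x ∈ C) (hy : y ∈ C) (hxy : x < y)
    (hzV : z ∈ V) (hz : z ∉ C) (hyz : y < z) (hn : ¬ R x y z) (hF : Free V R x y z) :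
    ∀ w ∈ C, w ≤ x ∨ w = y := by
  intro w hw
  by_contra! hc
  obtain ⟨hwx, hwy⟩ := hc
  have hwz : w ≠ z := fun e => hz (e ▸ hw)
  have hxz := hxy.trans hyz
  have f := hF w (h.subset hw) hwx.ne' hwy hwz
  rcases hwy.lt_or_gt with g | g
  · have s := h.side z hzV hz x hx w hw w hw y hy hwx g
    rw [bel_top hwx (g.trans hyz), bel_top g hyz] at s
    rw [bel_mid hwx g, bel_bot g hyz, bel_mid hwx (g.trans hyz)] at f
    tauto
  have t := (h.triple x hx y hy w hw hxy g).1
  rw [bel_top hxy g] at f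
  rcases hwz.lt_or_gt with g' | g'
  · have s := h.side z hzV hz x hx y hy x hx w hw hxy hwx
    rw [bel_top hxy hyz, bel_top hwx g'] at s
    rw [bel_mid hwx g'] at f
    tauto
  · have s := h.side z hzV hz x hx y hy x hx w hw hxy hwx
    rw [bel_top hxy hyz, bel_mid hxz g'] at s
    rw [bel_top hxz g'] at f
    tauto

theorem Block.eq_or_ge_of_free (h : Block V R Y G M C) (hx : x ∈ C) (hy : y ∈ C) (hxy : x < y)
    (hzV : z ∈ V) (hz : z ∉ C) (hzx : z < x) (hn : ¬ R z x y) (hF : Free V R z x y) :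
    ∀ w ∈ C, w = x ∨ y ≤ w := by
  intro w hw
  by_contra! hc
  obtain ⟨hwx, hwy⟩ := hc
  have hwz : w ≠ z := fun e => hz (e ▸ hw)
  have f := hF w (h.subset hw) hwz hwx hwy.ne
  rcases hwx.lt_or_gt with g | g
  · have t := (h.triple w hw x hx y hy g hxy).1
    rw [bel_bot g hxy] at f
    have s := h.side z hzV hz w hw x hx x hx y hy g hxy
    rw [bel_bot hzx hxy] at s
    rcases hwz.lt_or_gt with g' | g'
    · rw [bel_mid g' hzx] at s
      rw [bel_bot g' hzx] at f
      tauto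
    · rw [bel_bot g' g] at s
      rw [bel_mid g' g] at f
      tauto
  · have t := (h.triple x hx w hw y hy g hwy).1
    have s := h.side z hzV hz x hx w hw w hw y hy g hwy
    rw [bel_bot hzx g, bel_bot (hzx.trans g) hwy] at s
    rw [bel_top hzx g, bel_mid g hwy, bel_mid (hzx.trans g) hwy] at f
    tauto

theorem Block.packetClosed_right (h : Block V R Y G M C)
    (hE : PacketClosed V E)
    (hQ : ∀ i ∈ V, ∀ j ∈ V, ∀ k ∈ V, i < j → j < k → E i j k → OuterFree V R i j k) :
    PacketClosed V fun j k l => E j k l ∧ ¬ (j ∈ C ∧ k ∈ C ∧ l ∉ C ∧ ∃ i ∈ C, i < j) := by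
  intro a ha b hb c hc d hd hab hbc hcd
  obtain ⟨e1, e2, e3, e4⟩ := hE a ha b hb c hc d hd hab hbc hcd
  have hac := hab.trans hbc
  have hbd := hbc.trans hcd
  refine ⟨?_, ?_, ?_, ?_⟩
  · rintro ⟨p1, u1⟩ ⟨p2, u2⟩
    exact ⟨e1 p1 p2, fun ⟨m1, m2, m3, hi⟩ =>
      u2 ⟨m1, by_contra fun hcC => u1 ⟨m1, m2, hcC, hi⟩, m3, hi⟩⟩
  · rintro ⟨p1, u1⟩ ⟨p2, u2⟩
    exact ⟨e2 p1 p2, fun ⟨m1, m2, m3, i, hi, hia⟩ =>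
      u2 ⟨m2, by_contra fun hcC => u1 ⟨m1, m2, hcC, i, hi, hia⟩, m3, i, hi, hia.trans hab⟩⟩
  · rintro ⟨p1, u1⟩ ⟨p2, u2⟩
    refine ⟨e3 p1 p2, fun ⟨m1, m2, m3, i, hi, hia⟩ => ?_⟩
    have hbC : b ∉ C := fun hbC => u2 ⟨hbC, m2, m3, i, hi, hia.trans hab⟩
    obtain ⟨n, q, -⟩ := hQ a ha b hb c hc hab hbc p1
    have q := q i (h.subset hi) hia
    have t := (h.triple i hi a m1 c m2 hia hac).1
    have s := h.side b hb hbC i hi a m1 a m1 c m2 hia hac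
    rw [bel_top hia hab, bel_mid hab hbc] at s
    clear hE hQ h u1 u2 e1 e2 e3 e4
    grind
  · rintro ⟨p1, u1⟩ ⟨p2, u2⟩
    refine ⟨e4 p1 p2, fun ⟨m1, m2, m3, i, hi, hia⟩ => ?_⟩
    have hbC : b ∉ C := fun hbC => u2 ⟨hbC, m2, m3, i, hi, hia.trans hab⟩
    have hiV := h.subset hi
    have q1 := (hQ a ha b hb d hd hab hbd p1).2.1 i hiV hia
    have q2 := (hQ b hb c hc d hd hbc hcd p2).2.1 i hiV (hia.trans hab)
    have n := (hQ a ha c hc d hd hac hcd (e4 p1 p2)).1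
    have s1 := h.side d hd m3 i hi a m1 a m1 c m2 hia hac
    have s2 := h.side d hd m3 i hi c m2 a m1 c m2 (hia.trans hac) hac
    have s3 := h.side b hb hbC i hi a m1 i hi c m2 hia (hia.trans hac)
    rw [bel_top hia (hac.trans hcd), bel_top hac hcd] at s1
    rw [bel_top (hia.trans hac) hcd, bel_top hac hcd] at s2
    rw [bel_top hia hab, bel_mid (hia.trans hab) hbc] at s3
    clear hE hQ h u1 u2 e1 e2 e3 e4
    grind

theorem Block.packetClosed_left (h : Block V R Y G M C)
    (hE : PacketClosed V E)
    (hQ : ∀ i ∈ V, ∀ j ∈ V, ∀ k ∈ V, i < j → j < k → E i j k → OuterFree V R i j k) :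
    PacketClosed V fun l i j => E l i j ∧ ¬ (l ∉ C ∧ i ∈ C ∧ j ∈ C ∧ ∃ k ∈ C, j < k) := by
  intro a ha b hb c hc d hd hab hbc hcd
  obtain ⟨e1, e2, e3, e4⟩ := hE a ha b hb c hc d hd hab hbc hcd
  have hac := hab.trans hbc
  have hbd := hbc.trans hcd
  refine ⟨?_, ?_, ?_, ?_⟩
  · rintro ⟨p1, u1⟩ ⟨p2, u2⟩
    refine ⟨e1 p1 p2, fun ⟨m1, m2, m3, k, hk, hdk⟩ => ?_⟩
    have hcC : c ∉ C := fun hcC => u2 ⟨m1, hcC, m3, k, hk, hdk⟩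
    have hkV := h.subset hk
    have q1 := (hQ a ha b hb c hc hab hbc p1).2.2 k hkV (hcd.trans hdk)
    have q2 := (hQ a ha c hc d hd hac hcd p2).2.2 k hkV hdk
    have n := (hQ a ha b hb d hd hab hbd (e1 p1 p2)).1
    have s1 := h.side a ha m1 b m2 d m3 b m2 k hk hbd (hbd.trans hdk)
    have s2 := h.side a ha m1 b m2 d m3 d m3 k hk hbd hdk
    have s3 := h.side c hc hcC d m3 k hk b m2 k hk hdk (hbd.trans hdk)
    rw [bel_bot hab hbd, bel_bot hab (hbd.trans hdk)] at s1
    rw [bel_bot hab hbd, bel_bot (hab.trans hbd) hdk] at s2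
    rw [bel_bot hcd hdk, bel_mid hbc (hcd.trans hdk)] at s3
    clear hE hQ h u1 u2 e1 e2 e3 e4
    grind
  · rintro ⟨p1, u1⟩ ⟨p2, u2⟩
    refine ⟨e2 p1 p2, fun ⟨m1, m2, m3, k, hk, hdk⟩ => ?_⟩
    have hcC : c ∉ C := fun hcC => u1 ⟨m1, m2, hcC, d, m3, hcd⟩
    obtain ⟨n, -, q⟩ := hQ b hb c hc d hd hbc hcd p2
    have q := q k (h.subset hk) hdk
    have t := (h.triple b m2 d m3 k hk hbd hdk).1
    have s := h.side c hc hcC b m2 d m3 d m3 k hk hbd hdk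
    rw [bel_mid hbc hcd, bel_bot hcd hdk] at s
    clear hE hQ h u1 u2 e1 e2 e3 e4
    grind
  · rintro ⟨p1, u1⟩ ⟨p2, u2⟩
    exact ⟨e3 p1 p2, fun ⟨m1, m2, m3, hk⟩ =>
      u1 ⟨m1, by_contra fun hbC => u2 ⟨hbC, m2, m3, hk⟩, m2, d, m3, hcd⟩⟩
  · rintro ⟨p1, u1⟩ ⟨p2, u2⟩
    exact ⟨e4 p1 p2, fun ⟨m1, m2, m3, hk⟩ =>
      u1 ⟨m1, by_contra fun hbC => u2 ⟨hbC, m2, m3, hk⟩, m3, hk⟩⟩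

/-- The triples of a maximal block can be adjoined after any closure of free triples. -/
theorem Block.packetConsistent_adjoin (hR : PacketConsistent V R) (hY : PacketConsistent V Y)
    (hG : PacketClosed V G) (hRY : ∀ i j k, i < j → j < k → R i j k → Y i j k)
    (hM : ∀ p ∈ V, ∀ q ∈ V, ∀ r ∈ V, p < q → q < r → Y p q r → ¬ R p q r →
      BaseFree V R p q r → _root_.level V R p q r ≤ M)
    (h : Block V R Y G M C) (hmax : ∀ z, z ∉ C → ¬ Block V R Y G M (insert z C))
    {S : ℕ → ℕ → ℕ → Prop}
    (hS : ∀ i ∈ V, ∀ j ∈ V, ∀ k ∈ V, i < j → j < k → S i j k →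
      (¬ R i j k ∧ Y i j k ∧ G i j k) ∧ E i j k ∧ Free V R i j k)
    (hE : PacketClosed V E)
    (hind : ∀ P : ℕ → ℕ → ℕ → Prop, PacketClosed V P →
      (∀ i ∈ V, ∀ j ∈ V, ∀ k ∈ V, i < j → j < k → S i j k → P i j k) →
      ∀ i ∈ V, ∀ j ∈ V, ∀ k ∈ V, i < j → j < k → E i j k → P i j k)
    (hRE : PacketConsistent V fun i j k => R i j k ∨ E i j k) :
    PacketConsistent V (AdjoinTriples (fun i j k => R i j k ∨ E i j k) C) := by
  have hQ := hind _ (packetClosed_outerFree hR) fun i hi j hj k hk hij hjk hs =>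
    (hS i hi j hj k hk hij hjk hs).2.2.outerFree hij hjk (hS i hi j hj k hk hij hjk hs).1.1
  have hright := hind _ (h.packetClosed_right hE hQ)
    fun j hj k hk l hl hjk hkl hs => ⟨(hS j hj k hk l hl hjk hkl hs).2.1, by
      rintro ⟨hjC, hkC, hlC, -⟩
      obtain ⟨ht, -, hF⟩ := hS j hj k hk l hl hjk hkl hs
      exact hmax l hlC (h.insert_right hR hY hG hRY hM hjC hkC hjk
        (h.eq_or_le_of_free hjC hkC hjk hl hlC hkl ht.1 hF) hl hkl ht hF)⟩
  have hleft := hind _ (h.packetClosed_left hE hQ)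
    fun l hl i hi j hj hli hij hs => ⟨(hS l hl i hi j hj hli hij hs).2.1, by
      rintro ⟨hlC, hiC, hjC, -⟩
      obtain ⟨ht, -, hF⟩ := hS l hl i hi j hj hli hij hs
      exact hmax l hlC (h.insert_left hR hY hG hRY hM hiC hjC hij
        (h.eq_or_ge_of_free hiC hjC hij hl hlC hli ht.1 hF) hl hli ht hF)⟩
  refine hRE.adjoinTriples fun i hi j hj k hk hij hjk hn l hl hlC => ?_
  have hik := hij.trans hjk
  have hiV := h.subset hi
  have hjV := h.subset hj
  have hkV := h.subset hk
  have s1 := h.side l hl hlC i hi j hj j hj k hk hij hjk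
  have s2 := h.side l hl hlC i hi j hj i hi k hk hij hik
  have hli : l ≠ i := fun e => hlC (e ▸ hi)
  have hlj : l ≠ j := fun e => hlC (e ▸ hj)
  have hlk : l ≠ k := fun e => hlC (e ▸ hk)
  rcases hli.lt_or_gt with g | g
  · have u : ¬ E l i j := fun e =>
      (hleft l hl i hiV j hjV g hij e).2 ⟨hlC, hi, hj, k, hk, hjk⟩
    have p := packet hRE hl hiV hjV hkV g hij hjk
    rw [bel_bot g hij, bel_bot g hik] at s2
    rw [bel_bot g hij, bel_bot (g.trans hij) hjk] at s1
    rw [bel_bot g hij, bel_bot g hik, bel_bot (g.trans hij) hjk]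
    clear hright hleft hQ hmax hM hind hS
    grind
  rcases hlj.lt_or_gt with g' | g'
  · have p := packet hRE hiV hl hjV hkV g g' hjk
    rw [bel_mid g g', bel_mid g (g'.trans hjk)] at s2
    rw [bel_mid g g', bel_bot g' hjk] at s1
    rw [bel_mid g g', bel_mid g (g'.trans hjk), bel_bot g' hjk]
    clear hright hleft hQ hmax hM hind hS
    grind
  rcases hlk.lt_or_gt with g'' | g''
  · have p := packet hRE hiV hjV hl hkV hij g' g''
    rw [bel_top hij g', bel_mid g g''] at s2
    rw [bel_top hij g', bel_mid g' g''] at s1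
    rw [bel_top hij g', bel_mid g g'', bel_mid g' g'']
    clear hright hleft hQ hmax hM hind hS
    grind
  · have u : ¬ E j k l := fun e =>
      (hright j hjV k hkV l hl hjk g'' e).2 ⟨hj, hk, hlC, i, hi, hij⟩
    have p := packet hRE hiV hjV hkV hl hij hjk g''
    rw [bel_top hij g', bel_top hik g''] at s2
    rw [bel_top hij g', bel_top hjk g''] at s1
    rw [bel_top hij g', bel_top hik g'', bel_top hjk g'']
    clear hright hleft hQ hmax hM hind hS
    grind

end MaximalBlock

section Translation

variable {n : ℕ} {S T X : Finset (Finset ℕ)} {V : Finset ℕ} {P R R' : ℕ → ℕ → ℕ → Prop}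

/-- The ternary relation of a family of triples. -/
def TripleRel (T : Finset (Finset ℕ)) (a b c : ℕ) : Prop :=
  ({a, b, c} : Finset ℕ) ∈ T

theorem PacketClosed.congr (hR : PacketClosed V R)
    (h : ∀ a ∈ V, ∀ b ∈ V, ∀ c ∈ V, a < b → b < c → (R a b c ↔ R' a b c)) :
    PacketClosed V R' := by
  intro a ha b hb c hc d hd hab hbc hcd
  rw [← h a ha b hb c hc hab hbc, ← h a ha b hb d hd hab (hbc.trans hcd),
    ← h a ha c hc d hd (hab.trans hbc) hcd, ← h b hb c hc d hd hbc hcd]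
  exact hR a ha b hb c hc d hd hab hbc hcd

theorem PacketConsistent.congr (hR : PacketConsistent V R)
    (h : ∀ a ∈ V, ∀ b ∈ V, ∀ c ∈ V, a < b → b < c → (R a b c ↔ R' a b c)) :
    PacketConsistent V R' :=
  ⟨hR.1.congr h, hR.2.congr fun a ha b hb c hc hab hbc => not_congr (h a ha b hb c hc hab hbc)⟩

theorem triple_inj {a b c a' b' c' : ℕ} (hab : a < b) (hbc : b < c) (hab' : a' < b')
    (hbc' : b' < c') (h : ({a, b, c} : Finset ℕ) = {a', b', c'}) :
    a = a' ∧ b = b' ∧ c = c' := by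
  have h' := fun w => Finset.ext_iff.1 h w
  simp only [mem_insert, mem_singleton] at h'
  have := h' a
  have := h' b
  have := h' c
  have := h' a'
  have := h' b'
  have := h' c'
  omega

theorem triple_mem_binom {a b c : ℕ} (ha : a ∈ box n) (hb : b ∈ box n) (hc : c ∈ box n)
    (hab : a < b) (hbc : b < c) : ({a, b, c} : Finset ℕ) ∈ binom n 3 := by
  refine mem_powersetCard.2 ⟨by simp [insert_subset_iff, ha, hb, hc], ?_⟩
  exact card_eq_three.2 ⟨a, b, c, hab.ne, (hab.trans hbc).ne, hbc.ne, rfl⟩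

theorem exists_triple_of_mem_binom {I : Finset ℕ} (hI : I ∈ binom n 3) :
    ∃ a ∈ box n, ∃ b ∈ box n, ∃ c ∈ box n, a < b ∧ b < c ∧ I = {a, b, c} := by
  obtain ⟨hI, h3⟩ := mem_powersetCard.1 hI
  set f := I.orderEmbOfFin h3
  have hf : ∀ i, f i ∈ box n := fun i => hI (I.orderEmbOfFin_mem h3 i)
  refine ⟨f 0, hf 0, f 1, hf 1, f 2, hf 2, ?_, ?_, ?_⟩
  · exact f.strictMono (by decide)
  · exact f.strictMono (by decide)
  · apply coe_injective
    rw [← I.range_orderEmbOfFin h3]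
    ext w
    simp only [f, Set.mem_range, Fin.exists_fin_succ, coe_insert, coe_singleton,
      Set.mem_insert_iff, Set.mem_singleton_iff, eq_comm (a := w)]
    simp

theorem singleton_union_pair (q i j : ℕ) : ({q} ∪ {i, j} : Finset ℕ) = {q, i, j} := rfl

theorem isClosedSet_iff : IsClosedSet n 2 T ↔ PacketClosed (box n) (TripleRel T) := by
  have rot : ∀ q i j : ℕ, ({q, i, j} : Finset ℕ) = {i, j, q} := fun q i j => by
    rw [insert_comm, pair_comm q j]
  constructor
  · intro h a ha b hb c hc d hd hab hbc hcd
    have key : ∀ q ∈ box n, ∀ i ∈ box n, ∀ j ∈ box n, ∀ k ∈ box n, i ≠ q → j ≠ q → k ≠ q →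
        i < j → j < k → TripleRel T q i j → TripleRel T q j k → TripleRel T q i k := by
      intro q hq i hi j hj k hk h1 h2 h3 hij hjk
      exact h {q} (mem_powersetCard.2 ⟨by simpa using hq, rfl⟩) i hi j hj k hk (by simpa using h1)
        (by simpa using h2) (by simpa using h3) hij hjk
    have k1 := key a ha b hb c hc d hd (by omega) (by omega) (by omega) hbc hcd
    have k2 := key b hb a ha c hc d hd (by omega) (by omega) (by omega) (by omega) hcd
    have k3 := key c hc a ha b hb d hd (by omega) (by omega) (by omega) (by omega) (by omega)
    have k4 := key d hd a ha b hb c hc (by omega) (by omega) (by omega) (by omega) hbc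
    unfold TripleRel at *
    rw [insert_comm b a {c}, insert_comm b a {d}] at k2
    rw [rot c a b, insert_comm c b {d}, insert_comm c a {d}] at k3
    rw [rot d a b, rot d b c, rot d a c] at k4
    exact ⟨k1, k2, k3, k4⟩
  · intro h I hI i hi j hj k hk h1 h2 h3 hij hjk
    obtain ⟨hI, hI1⟩ := mem_powersetCard.1 hI
    obtain ⟨q, rfl⟩ := card_eq_one.1 hI1
    simp only [mem_singleton, singleton_subset_iff] at h1 h2 h3 hI
    simp only [singleton_union_pair]
    rcases lt_or_gt_of_ne h1 with g | g
    · rcases lt_or_gt_of_ne h2 with g' | g'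
      · rcases lt_or_gt_of_ne h3 with g'' | g''
        · rw [rot q i j, rot q j k, rot q i k]
          exact (h i hi j hj k hk q hI hij hjk g'').2.2.2
        · rw [rot q i j, insert_comm q j {k}, insert_comm q i {k}]
          exact (h i hi j hj q hI k hk hij g' g'').2.2.1
      · rw [insert_comm q i {j}, insert_comm q i {k}]
        exact (h i hi q hI j hj k hk g g' hjk).2.1
    · exact (h q hI i hi j hj k hk g hij hjk).1

theorem consistent_iff :
    Consistent n 2 T ↔ T ⊆ binom n 3 ∧ PacketConsistent (box n) (TripleRel T) := by
  have h : ∀ a ∈ box n, ∀ b ∈ box n, ∀ c ∈ box n, a < b → b < c →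
      (TripleRel (binom n 3 \ T) a b c ↔ ¬ TripleRel T a b c) := by
    intro a ha b hb c hc hab hbc
    simp [TripleRel, triple_mem_binom ha hb hc hab hbc]
  simp only [Consistent, isClosedSet_iff, PacketConsistent]
  exact and_congr_right fun _ => and_congr_right fun _ => ⟨fun h' => h'.congr h,
    fun h' => h'.congr fun a ha b hb c hc hab hbc => (h a ha b hb c hc hab hbc).symm⟩

theorem mem_closureHB {I : Finset ℕ} : I ∈ closureHB n 2 S ↔
    I ∈ binom n 3 ∧ ∀ T ⊆ binom n 3, S ⊆ T → IsClosedSet n 2 T → I ∈ T := by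
  simp [closureHB]

theorem closureHB_subset_binom : closureHB n 2 S ⊆ binom n 3 := fun _ hI => (mem_closureHB.1 hI).1

theorem subset_closureHB (hS : S ⊆ binom n 3) : S ⊆ closureHB n 2 S := fun _ hI =>
  mem_closureHB.2 ⟨hS hI, fun _ _ hST _ => hST hI⟩

theorem closureHB_subset (hT : T ⊆ binom n 3) (hST : S ⊆ T) (h : IsClosedSet n 2 T) :
    closureHB n 2 S ⊆ T := fun _ hI => (mem_closureHB.1 hI).2 T hT hST h

theorem isClosedSet_closureHB : IsClosedSet n 2 (closureHB n 2 S) := by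
  rw [isClosedSet_iff]
  intro a ha b hb c hc d hd hab hbc hcd
  have key : ∀ T, T ⊆ binom n 3 → S ⊆ T → IsClosedSet n 2 T → _ := fun T hT hST h =>
    isClosedSet_iff.1 h a ha b hb c hc d hd hab hbc hcd
  have m1 := triple_mem_binom ha hb hd hab (hbc.trans hcd)
  have m2 := triple_mem_binom ha hc hd (hab.trans hbc) hcd
  have out : ∀ {i j k T}, TripleRel (closureHB n 2 S) i j k → T ⊆ binom n 3 → S ⊆ T →
    IsClosedSet n 2 T → TripleRel T i j k := fun h hT hST hc => closureHB_subset hT hST hc h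
  refine ⟨fun h1 h2 => mem_closureHB.2 ⟨m1, fun T hT hST h => ?_⟩,
    fun h1 h2 => mem_closureHB.2 ⟨m1, fun T hT hST h => ?_⟩,
    fun h1 h2 => mem_closureHB.2 ⟨m2, fun T hT hST h => ?_⟩,
    fun h1 h2 => mem_closureHB.2 ⟨m2, fun T hT hST h => ?_⟩⟩
  · exact (key T hT hST h).1 (out h1 hT hST h) (out h2 hT hST h)
  · exact (key T hT hST h).2.1 (out h1 hT hST h) (out h2 hT hST h)
  · exact (key T hT hST h).2.2.1 (out h1 hT hST h) (out h2 hT hST h)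
  · exact (key T hT hST h).2.2.2 (out h1 hT hST h) (out h2 hT hST h)

theorem closureHB_induction (hS : S ⊆ binom n 3) (hP : PacketClosed (box n) P)
    (h : ∀ i ∈ box n, ∀ j ∈ box n, ∀ k ∈ box n, i < j → j < k → TripleRel S i j k → P i j k) :
    ∀ i ∈ box n, ∀ j ∈ box n, ∀ k ∈ box n, i < j → j < k →
      TripleRel (closureHB n 2 S) i j k → P i j k := by
  classical
  set T := (binom n 3).filter fun I => ∃ a b c, a < b ∧ b < c ∧ I = {a, b, c} ∧ P a b c with hT
  have hTP : ∀ i ∈ box n, ∀ j ∈ box n, ∀ k ∈ box n, i < j → j < k →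
      (P i j k ↔ TripleRel T i j k) := by
    intro i hi j hj k hk hij hjk
    constructor
    · exact fun h => mem_filter.2 ⟨triple_mem_binom hi hj hk hij hjk, i, j, k, hij, hjk, rfl, h⟩
    · intro h
      obtain ⟨-, a, b, c, hab, hbc, he, hp⟩ := mem_filter.1 h
      obtain ⟨rfl, rfl, rfl⟩ := triple_inj hij hjk hab hbc he
      exact hp
  have hST : S ⊆ T := by
    intro I hI
    obtain ⟨a, ha, b, hb, c, hc, hab, hbc, rfl⟩ := exists_triple_of_mem_binom (hS hI)
    exact (hTP a ha b hb c hc hab hbc).1 (h a ha b hb c hc hab hbc hI)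
  intro i hi j hj k hk hij hjk he
  exact (hTP i hi j hj k hk hij hjk).2
    (closureHB_subset (filter_subset _ _) hST (isClosedSet_iff.2 (hP.congr hTP)) he)

theorem adjoinTriples_triple_iff {a b c i j k : ℕ} (hab : a < b) (hbc : b < c) (hij : i < j)
    (hjk : j < k) :
    AdjoinTriples (TripleRel X) {a, b, c} i j k ↔ TripleRel (X ∪ {{a, b, c}}) i j k := by
  unfold AdjoinTriples TripleRel
  rw [mem_union, mem_singleton]
  refine or_congr_right ⟨fun h => ?_, fun h => ?_⟩
  · simp only [mem_insert, mem_singleton] at h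
    obtain ⟨rfl, rfl, rfl⟩ : i = a ∧ j = b ∧ k = c := by omega
    rfl
  · simp [← h]

theorem free_of_packetConsistent {a b c : ℕ} (hR : PacketConsistent V R) (ha : a ∈ V)
    (hb : b ∈ V) (hc : c ∈ V) (hab : a < b) (hbc : b < c) (hn : ¬ R a b c)
    (h : PacketConsistent V (AdjoinTriples R {a, b, c})) : Free V R a b c := by
  intro l hl hla hlb hlc
  have hac := hab.trans hbc
  have hlC : l ∉ ({a, b, c} : Finset ℕ) := by simp [hla, hlb, hlc]
  have m : AdjoinTriples R {a, b, c} a b c := .inr (by simp)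
  have e1 : ∀ i j, AdjoinTriples R {a, b, c} l i j ↔ R l i j := by simp [AdjoinTriples, hlC]
  have e2 : ∀ i j, AdjoinTriples R {a, b, c} i l j ↔ R i l j := by simp [AdjoinTriples, hlC]
  have e3 : ∀ i j, AdjoinTriples R {a, b, c} i j l ↔ R i j l := by simp [AdjoinTriples, hlC]
  rcases hla.lt_or_gt with g1 | g1
  · have p := packet hR hl ha hb hc g1 hab hbc
    have q := packet h hl ha hb hc g1 hab hbc
    simp only [e1] at q
    rw [bel_bot g1 hab, bel_bot g1 hac, bel_bot (g1.trans hab) hbc]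
    clear h hR e1 e2 e3
    grind
  rcases hlb.lt_or_gt with g2 | g2
  · have p := packet hR ha hl hb hc g1 g2 hbc
    have q := packet h ha hl hb hc g1 g2 hbc
    simp only [e1, e2] at q
    rw [bel_mid g1 g2, bel_mid g1 (g2.trans hbc), bel_bot g2 hbc]
    clear h hR e1 e2 e3
    grind
  rcases hlc.lt_or_gt with g3 | g3
  · have p := packet hR ha hb hl hc hab g2 g3
    have q := packet h ha hb hl hc hab g2 g3
    simp only [e2, e3] at q
    rw [bel_top hab g2, bel_mid g1 g3, bel_mid g2 g3]
    clear h hR e1 e2 e3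
    grind
  · have p := packet hR ha hb hc hl hab hbc g3
    have q := packet h ha hb hc hl hab hbc g3
    simp only [e3] at q
    rw [bel_top hab g2, bel_top hac g3, bel_top hbc g3]
    clear h hR e1 e2 e3
    grind

theorem consistent_union_singleton_iff {a b c : ℕ} (hX : Consistent n 2 X) (ha : a ∈ box n)
    (hb : b ∈ box n) (hc : c ∈ box n) (hab : a < b) (hbc : b < c) (hn : ¬ TripleRel X a b c) :
    Consistent n 2 (X ∪ {{a, b, c}}) ↔ Free (box n) (TripleRel X) a b c := by
  obtain ⟨hX, hR⟩ := consistent_iff.1 hX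
  rw [consistent_iff]
  constructor
  · rintro ⟨-, h⟩
    exact free_of_packetConsistent hR ha hb hc hab hbc hn (h.congr fun i _ j _ k _ hij hjk =>
      (adjoinTriples_triple_iff hab hbc hij hjk).symm)
  · intro h
    refine ⟨union_subset hX (singleton_subset_iff.2 (triple_mem_binom ha hb hc hab hbc)),
      (hR.adjoinTriples (C := {a, b, c}) ?_).congr fun i _ j _ k _ hij hjk =>
        adjoinTriples_triple_iff hab hbc hij hjk⟩
    intro i hi j hj k hk hij hjk _ l hl hlC
    simp only [mem_insert, mem_singleton, not_or] at hi hj hk hlC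
    obtain ⟨rfl, rfl, rfl⟩ : i = a ∧ j = b ∧ k = c := by omega
    exact h l hl hlC.1 hlC.2.1 hlC.2.2

end Translation

/-- There is an ascent `I₀ ∈ Asc(X,Y)` (one of maximum height) such that adjoining
it to any `𝓘 ⊆ Asc(X,Y)` with `X ∪ cl(𝓘)` consistent keeps consistency. -/
theorem exists_top_ascent (n : ℕ) (hn : 1 ≤ n) (X Y : Finset (Finset ℕ))
    (hX : Consistent n 2 X) (hY : Consistent n 2 Y) (hXY : X ⊂ Y) :
    ∃ I₀ ∈ ascSet n 2 X Y, ∀ S ⊆ ascSet n 2 X Y,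
      Consistent n 2 (X ∪ closureHB n 2 S) →
      Consistent n 2 (X ∪ closureHB n 2 (S ∪ {I₀})) := by
  classical
  obtain ⟨hXb, hR⟩ := consistent_iff.1 hX
  obtain ⟨hYb, hY'⟩ := consistent_iff.1 hY
  set V := box n
  set R := TripleRel X with hRdef
  set Q := TripleRel Y with hQdef
  have hRQ : ∀ i j k, i < j → j < k → R i j k → Q i j k := fun i j k _ _ h => hXY.1 h
  obtain ⟨I, hIY, hIX⟩ := exists_of_ssubset hXY
  obtain ⟨i, hi, j, hj, k, hk, hij, hjk, rfl⟩ := exists_triple_of_mem_binom (hYb hIY)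
  obtain ⟨i, hi, j, hj, k, hk, hijk⟩ := exists_baseFree hR hY' hRQ
    ⟨i, hi, j, hj, k, hk, hij, hjk, hIY, hIX⟩
  obtain ⟨⟨a, b, c⟩, habc, hmax⟩ := exists_max_image
    ((V ×ˢ V ×ˢ V).filter fun t : ℕ × ℕ × ℕ => t.1 < t.2.1 ∧ t.2.1 < t.2.2 ∧ Q t.1 t.2.1 t.2.2 ∧
      ¬ R t.1 t.2.1 t.2.2 ∧ BaseFree V R t.1 t.2.1 t.2.2)
    (fun t => level V R t.1 t.2.1 t.2.2)
    ⟨(i, j, k), by simpa [hi, hj, hk] using hijk⟩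
  simp only [mem_filter, mem_product] at habc hmax
  obtain ⟨⟨ha, hb, hc⟩, hab, hbc, hq, hn, hB⟩ := habc
  have hM : ∀ p ∈ V, ∀ q ∈ V, ∀ r ∈ V, p < q → q < r → Q p q r → ¬ R p q r →
      BaseFree V R p q r → level V R p q r ≤ level V R a b c :=
    fun p hp q hq r hr h1 h2 h3 h4 h5 => hmax (p, q, r) ⟨⟨hp, hq, hr⟩, h1, h2, h3, h4, h5⟩
  have hF : Free V R a b c := by
    by_contra hF
    obtain ⟨p, q, r, hp, hq, hr, h1, h2, h3, h4, h5, h6, -⟩ :=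
      hB.exists_level_lt hR hY' hRQ ha hb hc hab hbc hn hq hF
    exact h6.not_ge (hM p hp q hq r hr h1 h2 h3 h4 h5)
  have hasc : ascSet n 2 X Y ⊆ binom n 3 := fun I hI =>
    hYb (mem_sdiff.1 (mem_filter.1 hI).1).1
  have hI₀ : {a, b, c} ∈ ascSet n 2 X Y := mem_filter.2 ⟨mem_sdiff.2 ⟨hq, hn⟩,
    (consistent_union_singleton_iff hX ha hb hc hab hbc hn).2 hF⟩
  refine ⟨{a, b, c}, hI₀, fun S hS hSc => ?_⟩
  have hSb : S ⊆ binom n 3 := hS.trans hasc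
  have hSb' : S ∪ {{a, b, c}} ⊆ binom n 3 :=
    union_subset hSb (singleton_subset_iff.2 (hasc hI₀))
  set G := TripleRel (closureHB n 2 (S ∪ {{a, b, c}}))
  have hG : PacketClosed V G := isClosedSet_iff.1 isClosedSet_closureHB
  have hSG : ∀ {i j k}, TripleRel (S ∪ {{a, b, c}}) i j k → G i j k :=
    fun h => subset_closureHB hSb' h
  have hblock : Block V R Q G (level V R a b c) {a, b, c} :=
    Block.of_free ha hb hc hab hbc ⟨hn, hq, hSG (mem_union_right _ (mem_singleton_self _))⟩ hF
      le_rfl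
  obtain ⟨C, hC, hCmax⟩ := exists_max_image
    (V.powerset.filter fun C => {a, b, c} ⊆ C ∧ Block V R Q G (level V R a b c) C) card
    ⟨{a, b, c}, mem_filter.2 ⟨mem_powerset.2 hblock.subset, Subset.rfl, hblock⟩⟩
  obtain ⟨-, habcC, hC⟩ := mem_filter.1 hC
  have hCmax' : ∀ z, z ∉ C → ¬ Block V R Q G (level V R a b c) (insert z C) := by
    intro z hz h
    have := hCmax (insert z C) (mem_filter.2
      ⟨mem_powerset.2 h.subset, habcC.trans (subset_insert _ _), h⟩)
    rw [card_insert_of_notMem hz] at this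
    omega
  have hcl : closureHB n 2 S ⊆ closureHB n 2 (S ∪ {{a, b, c}}) :=
    closureHB_subset closureHB_subset_binom (subset_union_left.trans (subset_closureHB hSb'))
      isClosedSet_closureHB
  have hW := hC.packetConsistent_adjoin (E := TripleRel (closureHB n 2 S)) (S := TripleRel S)
    hR hY' hG hRQ hM hCmax' ?_ (isClosedSet_iff.1 isClosedSet_closureHB)
    (fun P hP h => closureHB_induction hSb hP h)
    ((consistent_iff.1 hSc).2.congr fun i _ j _ k _ _ _ => mem_union)
  · refine consistent_iff.2 ⟨union_subset hXb closureHB_subset_binom, hW.congr ?_⟩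
    intro i hi j hj k hk hij hjk
    refine Iff.trans ⟨?_, ?_⟩ mem_union.symm
    · rintro ((h | h) | ⟨h1, h2, h3⟩)
      · exact .inl h
      · exact .inr (hcl h)
      · exact .inr (hC.triple i h1 j h2 k h3 hij hjk).2.2
    · rintro (h | h)
      · exact .inl (.inl h)
      · refine closureHB_induction hSb' hW.1 ?_ i hi j hj k hk hij hjk h
        intro i _ j _ k _ hij hjk h
        rcases mem_union.1 h with h | h
        · exact .inl (.inr (subset_closureHB hSb h))
        · obtain ⟨rfl, rfl, rfl⟩ := triple_inj hij hjk hab hbc (mem_singleton.1 h)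
          exact .inr ⟨habcC (by simp), habcC (by simp), habcC (by simp)⟩
  · intro i hi j hj k hk hij hjk h
    obtain ⟨hYX, hc⟩ := mem_filter.1 (hS h)
    obtain ⟨hiY, hiX⟩ := mem_sdiff.1 hYX
    exact ⟨⟨hiX, hiY, hSG (mem_union_left _ h)⟩, subset_closureHB hSb h,
      (consistent_union_singleton_iff hX hi hj hk hij hjk hiX).1 hc⟩
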